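/- Let b be a rational function in the closed unit ball of H∞ with ‖b‖∞ = 1 that is not a finite Blaschke product. Let φ ∈ H(b) ∩ ball(H∞) with φ(ξ_j) ∈ Z_T(a) for 1 ≤ j ≤ p and φ(ξ_j) ∈ D for p+1 ≤ j ≤ n, and let u = (a₁ ∘ φ) · ∏_{j=p+1}^n (φ − φ(ξ_j))^{m_j} / a₁. Assume u ∈ H² and that ess sup_{ζ∈A_δ} |u(ζ)| → 0 as δ → 0, where A_δ = {ζ ∈ T : |φ(ζ)| ≥ 1 − δ}. Then the composition operator C_φ is compact on H(b). -/

import Mathlib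

open Complex MeasureTheory Set Filter

noncomputable section

attribute [local instance] Classical.propDecidable

/-- The open unit disk in `ℂ`. -/
def unitDisk : Set ℂ := Metric.ball 0 1

/-- The unit circle in `ℂ`. -/
def unitCircle : Set ℂ := Metric.sphere 0 1

/-- Membership in `H^∞`: analytic and bounded on the unit disk. -/
def MemHinf (f : ℂ → ℂ) : Prop :=
  DifferentiableOn ℂ f unitDisk ∧ ∃ C : ℝ, ∀ z ∈ unitDisk, ‖f z‖ ≤ C

/-- Membership in the closed unit ball of `H^∞`. -/
def MemBallHinf (f : ℂ → ℂ) : Prop :=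
  DifferentiableOn ℂ f unitDisk ∧ ∀ z ∈ unitDisk, ‖f z‖ ≤ 1

/-- `f` agrees on the closed unit disk with a rational function without poles there. -/
def IsRationalOnDisk (f : ℂ → ℂ) : Prop :=
  ∃ P Q : Polynomial ℂ, ∀ z ∈ Metric.closedBall (0:ℂ) 1,
    Q.eval z ≠ 0 ∧ f z = P.eval z / Q.eval z

/-- `f` is a finite Blaschke product (multiplicities are encoded by repetition). -/
def IsFiniteBlaschke (f : ℂ → ℂ) : Prop :=
  ∃ (γ : ℂ) (k : ℕ) (lam : Fin k → ℂ), ‖γ‖ = 1 ∧ (∀ i, lam i ∈ unitDisk) ∧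
    ∀ z ∈ unitDisk, f z = γ * ∏ i, (z - lam i) / (1 - (starRingEnd ℂ) (lam i) * z)

/-- The `k`-th Taylor coefficient of `f` at the origin. -/
def taylorCoeff (f : ℂ → ℂ) (k : ℕ) : ℂ := iteratedDeriv k f 0 / k.factorial

/-- Membership in the Hardy space `H²` (square-summable Taylor coefficients). -/
def MemH2 (f : ℂ → ℂ) : Prop :=
  DifferentiableOn ℂ f unitDisk ∧ Summable fun k => ‖taylorCoeff f k‖ ^ 2

/-- The squared `H²` norm. -/
def h2NormSq (f : ℂ → ℂ) : ℝ := ∑' k, ‖taylorCoeff f k‖ ^ 2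

/-- The `H²` inner product. -/
def h2Inner (f g : ℂ → ℂ) : ℂ :=
  ∑' k, (starRingEnd ℂ) (taylorCoeff f k) * taylorCoeff g k

/-- The polynomial `a₁(z) = ∏ⱼ (z − ξⱼ)^{mⱼ}`. -/
def a1fun {n : ℕ} (ξ : Fin n → ℂ) (m : Fin n → ℕ) : ℂ → ℂ :=
  fun z => ∏ j, (z - ξ j) ^ (m j)

/-- A decomposition `f = a₁ g + q` with `g ∈ H²`, `deg q ≤ N − 1`, witnessing membership
in `H(b) = a₁H² ⊕ P_{N−1}`. -/
def HbDecompOf {n : ℕ} (ξ : Fin n → ℂ) (m : Fin n → ℕ)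
    (f g : ℂ → ℂ) (q : Polynomial ℂ) : Prop :=
  MemH2 g ∧ q.degree < ((∑ j, m j : ℕ) : WithBot ℕ) ∧
    ∀ z ∈ unitDisk, f z = a1fun ξ m z * g z + q.eval z

/-- Membership in `H(b) = a₁ H² ⊕ P_{N−1}` (description of `H(b)` for `b` rational,
not a finite Blaschke product, whose pythagorean mate has boundary zeros `ξ` with
multiplicities `m`). -/
def MemHb {n : ℕ} (ξ : Fin n → ℂ) (m : Fin n → ℕ) (f : ℂ → ℂ) : Prop :=
  ∃ gq : (ℂ → ℂ) × Polynomial ℂ, HbDecompOf ξ m f gq.1 gq.2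

/-- The (unique) decomposition of a member of `H(b)`. -/
def hbDecomp {n : ℕ} (ξ : Fin n → ℂ) (m : Fin n → ℕ) (f : ℂ → ℂ) :
    (ℂ → ℂ) × Polynomial ℂ :=
  if h : MemHb ξ m f then h.choose else (0, 0)

/-- The squared norm `⦀a₁g + q⦀² = ‖g‖²_{H²} + ‖q‖²_{H²}` on `H(b)`. -/
def hbNormSq {n : ℕ} (ξ : Fin n → ℂ) (m : Fin n → ℕ) (f : ℂ → ℂ) : ℝ :=
  h2NormSq (hbDecomp ξ m f).1 + h2NormSq fun z => ((hbDecomp ξ m f).2).eval z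

/-- The inner product on `H(b)` induced by the decomposition. -/
def hbInner {n : ℕ} (ξ : Fin n → ℂ) (m : Fin n → ℕ) (f g : ℂ → ℂ) : ℂ :=
  h2Inner (hbDecomp ξ m f).1 (hbDecomp ξ m g).1 +
    h2Inner (fun z => ((hbDecomp ξ m f).2).eval z)
      (fun z => ((hbDecomp ξ m g).2).eval z)

/-- The Stolz angle (non-tangential approach region) at a boundary point `ξ`. -/
def stolzAngle (ξ : ℂ) (M : ℝ) : Set ℂ := {z ∈ unitDisk | ‖z - ξ‖ ≤ M * (1 - ‖z‖)}

/-- `f` has non-tangential limit `L` at `ξ`. -/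
def NTLimit (f : ℂ → ℂ) (ξ L : ℂ) : Prop :=
  ∀ M : ℝ, 1 < M → Tendsto f (nhdsWithin ξ (stolzAngle ξ M)) (nhds L)

/-- Radial boundary value of `f` at `ζ` (junk value if the radial limit does not exist). -/
def bdryVal (f : ℂ → ℂ) (ζ : ℂ) : ℂ :=
  limUnder (nhdsWithin (1:ℝ) (Set.Iio 1)) fun r : ℝ => f ((r : ℂ) * ζ)

/-- The full setting: `b` is a rational function in the closed unit ball of `H^∞` with
`‖b‖_∞ = 1` which is not a finite Blaschke product; `a` is its pythagorean mate (rational,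
outer — i.e. zero-free on the disk —, `a(0) > 0`, `|a|² + |b|² = 1` on the circle); the
`ξ j` are the distinct zeros of `a` on the unit circle, with multiplicities `m j`. -/
structure RationalSetting (b a : ℂ → ℂ) (n : ℕ) (ξ : Fin n → ℂ) (m : Fin n → ℕ) :
    Prop where
  b_diff : DifferentiableOn ℂ b unitDisk
  b_rat : IsRationalOnDisk b
  b_le_one : ∀ z ∈ unitDisk, ‖b z‖ ≤ 1
  b_norm_one : sSup ((fun z => ‖b z‖) '' unitDisk) = 1
  b_not_fbp : ¬ IsFiniteBlaschke b
  a_diff : DifferentiableOn ℂ a unitDisk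
  a_rat : IsRationalOnDisk a
  a_outer : ∀ z ∈ unitDisk, a z ≠ 0
  a_zero_pos : 0 < (a 0).re ∧ (a 0).im = 0
  pyth : ∀ ζ ∈ unitCircle, ‖a ζ‖ ^ 2 + ‖b ζ‖ ^ 2 = 1
  zeros_mem : ∀ j, ξ j ∈ unitCircle
  zeros_inj : Function.Injective ξ
  mult_pos : ∀ j, 0 < m j
  factor : ∃ g : ℂ → ℂ, IsRationalOnDisk g ∧ (∀ ζ ∈ unitCircle, g ζ ≠ 0) ∧
    ∀ z ∈ Metric.closedBall (0:ℂ) 1, a z = a1fun ξ m z * g z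

/-- The composition operator `C_φ` maps `H(b)` into itself and is bounded there
(with respect to the equivalent norm `⦀·⦀_b`). -/
def CompBddHb {n : ℕ} (ξ : Fin n → ℂ) (m : Fin n → ℕ) (φ : ℂ → ℂ) : Prop :=
  (∀ f, MemHb ξ m f → MemHb ξ m fun z => f (φ z)) ∧
  ∃ C : ℝ, ∀ f, MemHb ξ m f →
    hbNormSq ξ m (fun z => f (φ z)) ≤ C * hbNormSq ξ m f

/-- The composition operator `C_φ` is compact on `H(b)`: it is bounded and the image of
every sequence in the unit ball has a subsequence whose image converges in `H(b)`. -/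
def CompCompactHb {n : ℕ} (ξ : Fin n → ℂ) (m : Fin n → ℕ) (φ : ℂ → ℂ) : Prop :=
  CompBddHb ξ m φ ∧
  ∀ f : ℕ → ℂ → ℂ, (∀ k, MemHb ξ m (f k) ∧ hbNormSq ξ m (f k) ≤ 1) →
    ∃ (κ : ℕ → ℕ) (g : ℂ → ℂ), StrictMono κ ∧ MemHb ξ m g ∧
      Tendsto (fun i => hbNormSq ξ m fun z => f (κ i) (φ z) - g z) atTop (nhds 0)

/-- The composition operator `C_φ` is Hilbert–Schmidt on `H(b)`: it is bounded and the sum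
of `⦀C_φ e⦀²` over the orthonormal basis `{a₁ z^k}ₖ ∪ {z^j}_{j<N}` of
`(H(b), ⦀·⦀_b)` is finite (the finite part of the sum being automatically finite). -/
def CompHSHb {n : ℕ} (ξ : Fin n → ℂ) (m : Fin n → ℕ) (φ : ℂ → ℂ) : Prop :=
  CompBddHb ξ m φ ∧
  Summable fun k : ℕ => hbNormSq ξ m fun z => a1fun ξ m (φ z) * φ z ^ k

/-- The weighted composition operator `W_{u,φ} f = u · (f ∘ φ)` maps `H²` boundedly
into itself. -/
def WCompBddH2 (u φ : ℂ → ℂ) : Prop :=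
  (∀ f, MemH2 f → MemH2 fun z => u z * f (φ z)) ∧
  ∃ C : ℝ, ∀ f, MemH2 f →
    h2NormSq (fun z => u z * f (φ z)) ≤ C * h2NormSq f

/-- The weighted composition operator `W_{u,φ}` is compact on `H²`. -/
def WCompCompactH2 (u φ : ℂ → ℂ) : Prop :=
  WCompBddH2 u φ ∧
  ∀ f : ℕ → ℂ → ℂ, (∀ k, MemH2 (f k) ∧ h2NormSq (f k) ≤ 1) →
    ∃ (κ : ℕ → ℕ) (g : ℂ → ℂ), StrictMono κ ∧ MemH2 g ∧
      Tendsto (fun i => h2NormSq fun z => u z * f (κ i) (φ z) - g z) atTop (nhds 0)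

/-- The weighted composition operator `W_{u,φ}` is Hilbert–Schmidt on `H²`
(sum over the orthonormal basis `{z^k}` of `H²`). -/
def WCompHSH2 (u φ : ℂ → ℂ) : Prop :=
  WCompBddH2 u φ ∧ Summable fun k : ℕ => h2NormSq fun z => u z * φ z ^ k

/-- The function `u = (a₁ ∘ φ) · ∏_{j ≥ p} (φ − φ(ξⱼ))^{mⱼ} / a₁`, where `Λ j = φ(ξ j)`
are the non-tangential limits of `φ` at the zeros of the mate. -/
def ufun {n : ℕ} (p : ℕ) (ξ : Fin n → ℂ) (m : Fin n → ℕ) (Λ : Fin n → ℂ)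
    (φ : ℂ → ℂ) : ℂ → ℂ :=
  fun z => a1fun ξ m (φ z) *
    (∏ j ∈ Finset.univ.filter fun j : Fin n => p ≤ (j : ℕ), (φ z - Λ j) ^ (m j)) /
      a1fun ξ m z

/-- The reproducing kernel of the de Branges–Rovnyak space `H(c)`:
`k_λ^c(z) = (1 − conj(c(λ)) c(z)) / (1 − conj(λ) z)`, as a function of the parameter `λ`
and the evaluation point `z`. -/
def rkKernel (c : ℂ → ℂ) (lam z : ℂ) : ℂ :=
  (1 - (starRingEnd ℂ) (c lam) * c z) / (1 - (starRingEnd ℂ) lam * z)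

/-- `f` belongs to the reproducing kernel Hilbert space `H(c)` with squared norm at
most `t`: for all finite linear combinations of kernels,
`|⟨f, Σ αᵢ k_{λᵢ}⟩|² ≤ t · ‖Σ αᵢ k_{λᵢ}‖²`. -/
def HbRKBound (c f : ℂ → ℂ) (t : ℝ) : Prop :=
  ∀ (k : ℕ) (lam α : Fin k → ℂ), (∀ i, lam i ∈ unitDisk) →
    ‖∑ i, (starRingEnd ℂ) (α i) * f (lam i)‖ ^ 2 ≤
      t * (∑ i, ∑ j, α i * (starRingEnd ℂ) (α j) * rkKernel c (lam i) (lam j)).re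

/-- Membership in the de Branges–Rovnyak space `H(c)` (general RKHS definition). -/
def MemHbRK (c f : ℂ → ℂ) : Prop := ∃ t : ℝ, HbRKBound c f t

/-- `φ` has an angular derivative in the sense of Carathéodory at `ξ`:
`φ` and `φ'` have non-tangential limits at `ξ` and `|φ(ξ)| = 1`. -/
def HasADC (φ : ℂ → ℂ) (ξ : ℂ) : Prop :=
  ∃ L L' : ℂ, ‖L‖ = 1 ∧ NTLimit φ ξ L ∧ NTLimit (deriv φ) ξ L'

/-- The measure `μ_{u,φ}(E) = ∫_{φ⁻¹(E) ∩ T} |u|² dm` (boundary values on the circle,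
normalized Lebesgue measure). -/
def muMeas (u φ : ℂ → ℂ) (E : Set ℂ) : ENNReal :=
  (ENNReal.ofReal (2 * Real.pi))⁻¹ *
    ∫⁻ θ in Set.Ioc (0:ℝ) (2 * Real.pi),
      (if bdryVal φ (Complex.exp (θ * Complex.I)) ∈ E then
        ENNReal.ofReal (‖bdryVal u (Complex.exp (θ * Complex.I))‖ ^ 2) else 0)

/-- `μ_{u,φ}` is a Carleson measure: `μ(S(ζ,r)) ≤ M r` for all Carleson windows
`S(ζ,r) = {z : |z| ≤ 1, |z − ζ| ≤ r}`, `ζ ∈ T`, `0 < r < 1`. -/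
def IsCarleson (u φ : ℂ → ℂ) : Prop :=
  ∃ M : ℝ, 0 < M ∧ ∀ ζ ∈ unitCircle, ∀ r ∈ Set.Ioo (0:ℝ) 1,
    muMeas u φ (Metric.closedBall ζ r ∩ Metric.closedBall 0 1) ≤ ENNReal.ofReal (M * r)

/-- `μ_{u,φ}` is a vanishing Carleson measure: `sup_{ζ∈T} μ(S(ζ,r))/r → 0` as `r → 0`. -/
def IsVanishingCarleson (u φ : ℂ → ℂ) : Prop :=
  ∀ ε > (0:ℝ), ∃ r₀ ∈ Set.Ioo (0:ℝ) 1, ∀ r ∈ Set.Ioo (0:ℝ) r₀, ∀ ζ ∈ unitCircle,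
    muMeas u φ (Metric.closedBall ζ r ∩ Metric.closedBall 0 1) ≤ ENNReal.ofReal (ε * r)

/-- The reproducing kernel integral
`∫_T (1 − |w|²) |u(ξ)|² / |1 − conj(w) φ(ξ)|² dm(ξ)`. -/
def repKerInt (u φ : ℂ → ℂ) (w : ℂ) : ENNReal :=
  (ENNReal.ofReal (2 * Real.pi))⁻¹ *
    ∫⁻ θ in Set.Ioc (0:ℝ) (2 * Real.pi),
      ENNReal.ofReal ((1 - ‖w‖ ^ 2) * ‖bdryVal u (Complex.exp (θ * Complex.I))‖ ^ 2 /
        ‖1 - (starRingEnd ℂ) w * bdryVal φ (Complex.exp (θ * Complex.I))‖ ^ 2)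

open Topology in
lemma hk_hasSum {f : ℂ → ℂ} (hf : DifferentiableOn ℂ f unitDisk) {z : ℂ} (hz : z ∈ unitDisk) :
    HasSum (fun k => taylorCoeff f k * z ^ k) (f z) := by
  have h := Complex.hasSum_taylorSeries_on_ball (c := 0) (r := 1) (f := f) (z := z)
    (by simpa [unitDisk] using hf) (by simpa [unitDisk] using hz)
  have e : (fun k => taylorCoeff f k * z ^ k) =
      fun n : ℕ => ((n.factorial : ℂ))⁻¹ • (z - 0) ^ n • iteratedDeriv n f 0 := by
    funext k
    simp only [taylorCoeff, sub_zero, smul_eq_mul]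
    ring
  rw [e]; exact h

lemma hk_fps {f : ℂ → ℂ} {c : ℕ → ℂ}
    (h : ∀ z ∈ unitDisk, HasSum (fun k => c k * z ^ k) (f z)) :
    HasFPowerSeriesOnBall f (FormalMultilinearSeries.ofScalars ℂ c) 0 1 := by
  refine ⟨?_, by simp, ?_⟩
  · refine ENNReal.le_of_forall_nnreal_lt fun r hr => ?_
    refine FormalMultilinearSeries.le_radius_of_tendsto (l := 0) _ ?_
    have hr' : ((r : ℝ) : ℂ) ∈ unitDisk := by
      have : (r : ℝ) < 1 := by exact_mod_cast hr
      simpa [unitDisk] using this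
    have := (h _ hr').summable.tendsto_atTop_zero.norm
    simpa [FormalMultilinearSeries.ofScalars_norm] using this
  · intro y hy
    have hy' : y ∈ unitDisk := by
      simpa [unitDisk, Metric.mem_eball, edist_zero_right, ← ofReal_norm, ← ENNReal.ofReal_one, ENNReal.ofReal_lt_ofReal_iff] using hy
    have := h y hy'
    simpa [FormalMultilinearSeries.ofScalars_apply_eq, mul_comm] using this

lemma hk_differentiableOn {f : ℂ → ℂ} {c : ℕ → ℂ}
    (h : ∀ z ∈ unitDisk, HasSum (fun k => c k * z ^ k) (f z)) :
    DifferentiableOn ℂ f unitDisk := by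
  have := (hk_fps h).differentiableOn
  refine this.mono ?_
  intro y hy
  simpa [unitDisk, Metric.mem_eball, edist_zero_right, ← ofReal_norm, ← ENNReal.ofReal_one, ENNReal.ofReal_lt_ofReal_iff] using hy

lemma hk_coeff {f : ℂ → ℂ} {c : ℕ → ℂ}
    (h : ∀ z ∈ unitDisk, HasSum (fun k => c k * z ^ k) (f z)) (k : ℕ) :
    taylorCoeff f k = c k := by
  have h1 := (hk_fps h).hasFPowerSeriesAt
  have h2 : HasFPowerSeriesAt f (FormalMultilinearSeries.ofScalars ℂ (fun k => taylorCoeff f k)) 0 :=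
    (hk_fps (fun z hz => hk_hasSum (hk_differentiableOn h) hz)).hasFPowerSeriesAt
  have h3 := h1.eq_formalMultilinearSeries h2
  have h4 := congrArg (fun p => FormalMultilinearSeries.coeff p k) h3
  simpa using h4.symm

lemma hk_coeff_congr {f g : ℂ → ℂ} (hf : DifferentiableOn ℂ f unitDisk)
    (h : ∀ z ∈ unitDisk, g z = f z) (k : ℕ) : taylorCoeff g k = taylorCoeff f k :=
  hk_coeff (fun z hz => by rw [h z hz]; exact hk_hasSum hf hz) k

lemma hk_coeff_add {f g : ℂ → ℂ} (hf : DifferentiableOn ℂ f unitDisk)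
    (hg : DifferentiableOn ℂ g unitDisk) (k : ℕ) :
    taylorCoeff (fun z => f z + g z) k = taylorCoeff f k + taylorCoeff g k :=
  hk_coeff (c := fun k => taylorCoeff f k + taylorCoeff g k) (fun z hz => by
    simpa [add_mul] using (hk_hasSum hf hz).add (hk_hasSum hg hz)) k

lemma hk_coeff_sub {f g : ℂ → ℂ} (hf : DifferentiableOn ℂ f unitDisk)
    (hg : DifferentiableOn ℂ g unitDisk) (k : ℕ) :
    taylorCoeff (fun z => f z - g z) k = taylorCoeff f k - taylorCoeff g k :=
  hk_coeff (c := fun k => taylorCoeff f k - taylorCoeff g k) (fun z hz => by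
    simpa [sub_mul] using (hk_hasSum hf hz).sub (hk_hasSum hg hz)) k

lemma hk_coeff_smul {f : ℂ → ℂ} (hf : DifferentiableOn ℂ f unitDisk) (a : ℂ) (k : ℕ) :
    taylorCoeff (fun z => a * f z) k = a * taylorCoeff f k :=
  hk_coeff (c := fun k => a * taylorCoeff f k) (fun z hz => by
    simpa [mul_assoc] using (hk_hasSum hf hz).mul_left a) k

lemma hk_nonneg (f : ℂ → ℂ) : 0 ≤ h2NormSq f := tsum_nonneg fun _ => by positivity

lemma hk_norm_congr {f g : ℂ → ℂ} (hf : DifferentiableOn ℂ f unitDisk)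
    (h : ∀ z ∈ unitDisk, g z = f z) : h2NormSq g = h2NormSq f := by
  simp only [h2NormSq, hk_coeff_congr hf h]

lemma hk_mem_congr {f g : ℂ → ℂ} (hf : MemH2 f)
    (h : ∀ z ∈ unitDisk, g z = f z) : MemH2 g :=
  ⟨hf.1.congr h, by simpa only [hk_coeff_congr hf.1 h] using hf.2⟩

lemma hk_sq_add (a b : ℂ) : ‖a + b‖ ^ 2 ≤ 2 * ‖a‖ ^ 2 + 2 * ‖b‖ ^ 2 := by
  have := norm_add_le a b
  nlinarith [sq_nonneg (‖a‖ - ‖b‖), norm_nonneg (a + b), norm_nonneg a, norm_nonneg b]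

lemma hk_add {f g : ℂ → ℂ} (hf : MemH2 f) (hg : MemH2 g) :
    MemH2 (fun z => f z + g z) ∧
      h2NormSq (fun z => f z + g z) ≤ 2 * h2NormSq f + 2 * h2NormSq g := by
  have hs := (hf.2.mul_left 2).add (hg.2.mul_left 2)
  have hle : ∀ k, ‖taylorCoeff (fun z => f z + g z) k‖ ^ 2 ≤
      2 * ‖taylorCoeff f k‖ ^ 2 + 2 * ‖taylorCoeff g k‖ ^ 2 := fun k => by
    rw [hk_coeff_add hf.1 hg.1]; exact hk_sq_add _ _
  have hs' : Summable fun k => ‖taylorCoeff (fun z => f z + g z) k‖ ^ 2 :=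
    Summable.of_nonneg_of_le (fun _ => by positivity) hle hs
  refine ⟨⟨hf.1.add hg.1, hs'⟩, ?_⟩
  calc _ ≤ _ := hs'.tsum_le_tsum hle hs
    _ = _ := by rw [(hf.2.mul_left 2).tsum_add (hg.2.mul_left 2), tsum_mul_left, tsum_mul_left]; rfl

lemma hk_smul {f : ℂ → ℂ} (hf : MemH2 f) (a : ℂ) :
    MemH2 (fun z => a * f z) ∧ h2NormSq (fun z => a * f z) = ‖a‖ ^ 2 * h2NormSq f := by
  have h : ∀ k, ‖taylorCoeff (fun z => a * f z) k‖ ^ 2 = ‖a‖ ^ 2 * ‖taylorCoeff f k‖ ^ 2 :=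
    fun k => by rw [hk_coeff_smul hf.1, norm_mul, mul_pow]
  refine ⟨⟨hf.1.const_mul a, ?_⟩, ?_⟩
  · simp only [h]; exact hf.2.mul_left _
  · simp only [h2NormSq, h, tsum_mul_left]

lemma hk_sub {f g : ℂ → ℂ} (hf : MemH2 f) (hg : MemH2 g) :
    MemH2 (fun z => f z - g z) ∧
      h2NormSq (fun z => f z - g z) ≤ 2 * h2NormSq f + 2 * h2NormSq g := by
  have h := hk_add hf (hk_smul hg (-1)).1
  rw [(hk_smul hg (-1)).2] at h
  simpa [sub_eq_add_neg] using h

lemma hk_poly_hasSum (q : Polynomial ℂ) (z : ℂ) :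
    HasSum (fun k => q.coeff k * z ^ k) (q.eval z) := by
  rw [Polynomial.eval_eq_sum_range]
  refine hasSum_sum_of_ne_finset_zero fun k hk => ?_
  rw [Polynomial.coeff_eq_zero_of_natDegree_lt (by simpa using hk), zero_mul]

lemma hk_poly_coeff (q : Polynomial ℂ) (k : ℕ) :
    taylorCoeff (fun z => q.eval z) k = q.coeff k :=
  hk_coeff (fun z _ => hk_poly_hasSum q z) k

lemma hk_poly (q : Polynomial ℂ) : MemH2 (fun z => q.eval z) := by
  refine ⟨q.differentiable.differentiableOn, ?_⟩
  simp only [hk_poly_coeff]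
  refine summable_of_ne_finset_zero (s := Finset.range (q.natDegree + 1)) fun k hk => ?_
  rw [Polynomial.coeff_eq_zero_of_natDegree_lt (by simpa using hk)]; simp

lemma hk_poly_norm (q : Polynomial ℂ) :
    h2NormSq (fun z => q.eval z) = ∑ k ∈ Finset.range (q.natDegree + 1), ‖q.coeff k‖ ^ 2 := by
  simp only [h2NormSq, hk_poly_coeff]
  refine tsum_eq_sum fun k hk => ?_
  rw [Polynomial.coeff_eq_zero_of_natDegree_lt (by simpa using hk)]; simp

lemma hk_coeff_le {f : ℂ → ℂ} (hf : MemH2 f) (k : ℕ) : ‖taylorCoeff f k‖ ^ 2 ≤ h2NormSq f :=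
  hf.2.le_tsum k (fun _ _ => by positivity)

/-- The analytic function with given coefficients. -/
def ofC (c : ℕ → ℂ) (z : ℂ) : ℂ := ∑' k, c k * z ^ k

lemma hk_ofC_summable {c : ℕ → ℂ} {B : ℝ} (hc : ∀ k, ‖c k‖ ≤ B) {z : ℂ} (hz : z ∈ unitDisk) :
    Summable (fun k => c k * z ^ k) := by
  have hz' : ‖z‖ < 1 := by simpa [unitDisk] using hz
  refine Summable.of_norm_bounded (g := fun k => B * ‖z‖ ^ k)
    ((summable_geometric_of_lt_one (norm_nonneg z) hz').mul_left B) fun k => ?_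
  rw [norm_mul, norm_pow]
  exact mul_le_mul_of_nonneg_right (hc k) (by positivity)

lemma hk_ofC_hasSum {c : ℕ → ℂ} {B : ℝ} (hc : ∀ k, ‖c k‖ ≤ B) {z : ℂ} (hz : z ∈ unitDisk) :
    HasSum (fun k => c k * z ^ k) (ofC c z) := (hk_ofC_summable hc hz).hasSum

lemma hk_bdd_of_summable {c : ℕ → ℂ} (hc : Summable fun k => ‖c k‖ ^ 2) :
    ∃ B, ∀ k, ‖c k‖ ≤ B :=
  ⟨Real.sqrt (∑' k, ‖c k‖ ^ 2), fun k =>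
    Real.le_sqrt_of_sq_le (hc.le_tsum k (fun _ _ => by positivity))⟩

lemma hk_ofC {c : ℕ → ℂ} (hc : Summable fun k => ‖c k‖ ^ 2) :
    MemH2 (ofC c) ∧ (∀ k, taylorCoeff (ofC c) k = c k) := by
  obtain ⟨B, hB⟩ := hk_bdd_of_summable hc
  have h : ∀ k, taylorCoeff (ofC c) k = c k := hk_coeff fun z hz => hk_ofC_hasSum hB hz
  refine ⟨⟨hk_differentiableOn fun z hz => hk_ofC_hasSum hB hz, ?_⟩, h⟩
  simpa only [h] using hc

lemma hk_kernel_formula {G : ℂ → ℂ} (hG : DiffContOnCl ℂ G (Metric.ball 0 1)) {r : ℝ}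
    (h0 : 0 < r) (h1 : r < 1) :
    ∮ w in C(0, 1), (((w - r) ^ 2)⁻¹ - ((1 - r * w) ^ 2)⁻¹) * G w
      = (2 * Real.pi * I) * deriv G r := by
  have hr : (r : ℂ) ∈ Metric.ball (0 : ℂ) 1 := by simp [abs_of_pos h0, h1]
  have hne : ∀ w ∈ Metric.closedBall (0 : ℂ) 1, (1 - r * w : ℂ) ≠ 0 := by
    intro w hw h
    have hw' : ‖w‖ ≤ 1 := by simpa using hw
    have : (r : ℂ) * w = 1 := by linear_combination -h
    have h3 := congrArg norm this
    rw [norm_mul, norm_one, Complex.norm_of_nonneg h0.le] at h3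
    nlinarith [norm_nonneg w]
  have hne2 : ∀ w ∈ Metric.sphere (0 : ℂ) 1, (w - r : ℂ) ≠ 0 := by
    intro w hw h
    have hw' : ‖w‖ = 1 := by simpa using hw
    have : w = r := by linear_combination h
    rw [this, Complex.norm_of_nonneg h0.le] at hw'
    linarith
  have hcG : ContinuousOn G (Metric.closedBall 0 1) := hG.continuousOn_ball
  have hd : DiffContOnCl ℂ (dslope G (r : ℂ)) (Metric.ball 0 1) := by
    refine DiffContOnCl.mk_ball ?_ ?_
    · exact (Complex.differentiableOn_dslope (Metric.isOpen_ball.mem_nhds hr)).2 hG.differentiableOn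
    · exact (continuousOn_dslope (Metric.closedBall_mem_nhds_of_mem hr)).2
        ⟨hcG, hG.differentiableAt Metric.isOpen_ball hr⟩
  have hd2 : DiffContOnCl ℂ (fun w : ℂ => ((1 - (r : ℂ) * w) ^ 2)⁻¹ * G w) (Metric.ball 0 1) := by
    refine DiffContOnCl.mk_ball ?_ ?_
    · refine DifferentiableOn.mul (DifferentiableOn.inv (by fun_prop) ?_) hG.differentiableOn
      intro w hw
      exact pow_ne_zero 2 (hne w (Metric.ball_subset_closedBall hw))
    · refine ContinuousOn.mul (ContinuousOn.inv₀ (by fun_prop) ?_) hcG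
      intro w hw
      exact pow_ne_zero 2 (hne w hw)
  have e1 := hd.circleIntegral_sub_inv_smul hr
  have e2 := hd2.circleIntegral_eq_zero zero_le_one
  have e3 := circleIntegral.integral_sub_zpow_of_ne (n := -2) (by norm_num) 0 (r : ℂ) 1
  have ci1 : CircleIntegrable (fun w => (w - (r : ℂ))⁻¹ • dslope G (r : ℂ) w) 0 1 := by
    refine ContinuousOn.circleIntegrable zero_le_one ?_
    refine ContinuousOn.smul (ContinuousOn.inv₀ (by fun_prop) hne2) ?_
    exact hd.continuousOn_ball.mono Metric.sphere_subset_closedBall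
  have ci2 : CircleIntegrable (fun w : ℂ => ((1 - (r : ℂ) * w) ^ 2)⁻¹ * G w) 0 1 :=
    ContinuousOn.circleIntegrable zero_le_one
      (hd2.continuousOn_ball.mono Metric.sphere_subset_closedBall)
  have ci3 : CircleIntegrable (fun w => G r * (w - (r : ℂ)) ^ (-2 : ℤ)) 0 1 := by
    refine ContinuousOn.circleIntegrable zero_le_one ?_
    refine continuousOn_const.mul (ContinuousOn.zpow₀ (by fun_prop) _ ?_)
    intro w hw; exact Or.inl (hne2 w hw)
  have : ∮ w in C(0, 1), (((w - r) ^ 2)⁻¹ - ((1 - r * w) ^ 2)⁻¹) * G w =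
      ∮ w in C(0, 1), (((w - (r : ℂ))⁻¹ • dslope G (r : ℂ) w + G r * (w - (r : ℂ)) ^ (-2 : ℤ)) -
        ((1 - r * w) ^ 2)⁻¹ * G w) := by
    refine circleIntegral.integral_congr zero_le_one fun w hw => ?_
    have h := hne2 w hw
    have hwr : w ≠ r := fun h' => h (by rw [h']; ring)
    simp only [dslope_of_ne _ hwr, slope_def_field, smul_eq_mul, zpow_neg]
    have : (w - (r : ℂ)) ^ (2 : ℤ) = (w - r) ^ 2 := by norm_cast
    rw [this]
    field_simp
    ring
  have ci4 : CircleIntegrable (fun w => (w - (r : ℂ))⁻¹ • dslope G (r : ℂ) w +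
      G r * (w - (r : ℂ)) ^ (-2 : ℤ)) 0 1 := ci1.add ci3
  rw [this, circleIntegral.integral_sub ci4 ci2, circleIntegral.integral_add ci1 ci3, e1, e2,
    circleIntegral.integral_const_mul, e3]
  simp [dslope_same]

lemma hk_kernel_bound {G : ℂ → ℂ} {r ε K : ℝ} (h0 : 0 < r) (h1 : r < 1) (hε : 0 ≤ ε) (hK : 0 ≤ K)
    {w : ℂ} (hw : ‖w‖ = 1) (hGw : ‖G w‖ ≤ ε * ‖w - 1‖ + K * ‖w - 1‖ ^ 3) :
    ‖(((w - r) ^ 2)⁻¹ - ((1 - r * w) ^ 2)⁻¹) * G w‖ ≤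
      16 * ε * ((1 - r ^ 2) / ‖w - r‖ ^ 2) + 64 * K * (1 - r) := by
  have hd := norm_nonneg (w - 1)
  have he1 : 1 - r ≤ ‖w - r‖ := by
    have := norm_sub_norm_le w (r : ℂ)
    rw [hw, Complex.norm_of_nonneg h0.le] at this
    exact this
  have he : 0 < ‖w - r‖ := by linarith
  have hd2 : ‖w - 1‖ ≤ 2 * ‖w - r‖ := by
    have h2 : ‖w - 1‖ ≤ ‖w - r‖ + ‖(r : ℂ) - 1‖ := norm_sub_le_norm_sub_add_norm_sub _ _ _
    have h3 : ‖(r : ℂ) - 1‖ = 1 - r := by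
      rw [← Complex.ofReal_one, ← Complex.ofReal_sub, Complex.norm_real, Real.norm_eq_abs,
        abs_of_nonpos (by linarith)]; ring
    linarith
  have hconj : w * (starRingEnd ℂ) w = 1 := by
    rw [Complex.mul_conj, Complex.normSq_eq_norm_sq, hw]; simp
  have heq : ‖1 - r * w‖ = ‖w - r‖ := by
    have : 1 - r * w = w * (starRingEnd ℂ) (w - r) := by
      rw [map_sub, Complex.conj_ofReal, mul_sub, hconj]; ring
    rw [this, norm_mul, hw, one_mul, RCLike.norm_conj]
  have n1 : w - r ≠ 0 := norm_pos_iff.1 he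
  have n2 : 1 - r * w ≠ 0 := norm_pos_iff.1 (by rw [heq]; exact he)
  have hk : ((w - r) ^ 2)⁻¹ - ((1 - r * w) ^ 2)⁻¹ =
      ((1 + r) * (1 - r) * (1 - w) * (1 + w)) / ((w - r) ^ 2 * (1 - r * w) ^ 2) := by
    rw [inv_sub_inv (pow_ne_zero 2 n1) (pow_ne_zero 2 n2)]
    congr 1
    ring
  have hkn : ‖((w - r) ^ 2)⁻¹ - ((1 - r * w) ^ 2)⁻¹‖ ≤ 4 * (1 - r) * ‖w - 1‖ / ‖w - r‖ ^ 4 := by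
    rw [hk, norm_div, norm_mul, norm_mul, norm_mul, norm_mul, norm_pow, norm_pow, heq]
    have a1 : ‖(1 + r : ℂ)‖ ≤ 2 := by
      rw [← Complex.ofReal_one, ← Complex.ofReal_add, Complex.norm_of_nonneg (by linarith)]; linarith
    have a2 : ‖(1 - r : ℂ)‖ = 1 - r := by
      rw [← Complex.ofReal_one, ← Complex.ofReal_sub, Complex.norm_of_nonneg (by linarith)]
    have a3 : ‖1 - w‖ = ‖w - 1‖ := norm_sub_rev _ _
    have a4 : ‖1 + w‖ ≤ 2 := by
      have := norm_add_le 1 w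
      rw [hw, norm_one] at this; linarith
    rw [a2, a3, ← pow_add]
    have hr' : 0 ≤ 1 - r := by linarith
    refine div_le_div_of_nonneg_right ?_ (by positivity)
    calc ‖(1 + r : ℂ)‖ * (1 - r) * ‖w - 1‖ * ‖1 + w‖ ≤ 2 * (1 - r) * ‖w - 1‖ * 2 := by gcongr
      _ = _ := by ring
  rw [norm_mul]
  set d := ‖w - 1‖
  set e := ‖w - r‖
  have hr' : 0 ≤ 1 - r := by linarith
  have q1 : d ^ 2 / e ^ 2 ≤ 4 := by
    rw [div_le_iff₀ (by positivity)]; nlinarith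
  have q0 : 0 ≤ d ^ 2 / e ^ 2 := by positivity
  calc _ ≤ (4 * (1 - r) * d / e ^ 4) * (ε * d + K * d ^ 3) := by gcongr
    _ = 4 * ε * ((1 - r) / e ^ 2) * (d ^ 2 / e ^ 2) + 4 * K * (1 - r) * (d ^ 2 / e ^ 2) ^ 2 := by
        field_simp
    _ ≤ 4 * ε * ((1 - r ^ 2) / e ^ 2) * 4 + 4 * K * (1 - r) * 4 ^ 2 := by
        have : 1 - r ≤ 1 - r ^ 2 := by nlinarith
        have : 0 ≤ 1 - r ^ 2 := by linarith
        gcongr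
    _ = _ := by ring

lemma hk_poisson_one {w : ℂ} (hw : ‖w‖ < 1) :
    Real.circleAverage (fun z => (1 - ‖w‖ ^ 2) / ‖z - w‖ ^ 2) 0 1 = 1 := by
  have h := (diffContOnCl_const (c := (1 : ℂ)) (s := Metric.ball (0:ℂ) 1)
    (𝕜 := ℂ)).circleAverage_re_herglotzRieszKernel_smul' (w := w) (by simpa using hw)
  have h2 := (diffContOnCl_const (c := (1 : ℂ)) (s := Metric.ball (0:ℂ) 1)
    (𝕜 := ℂ)).circleAverage_poissonKernel_smul' (w := w) (by simpa using hw)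
  have h3 : Real.circleAverage (fun z => ((((1 - ‖w‖ ^ 2) / ‖z - w‖ ^ 2 : ℝ)) : ℂ)) 0 1 = 1 := by
    rw [← h2]
    refine Real.circleAverage_congr_sphere fun z hz => ?_
    have : ‖z‖ = 1 := by simpa using hz
    simp [this]
  have h4 : Real.circleAverage (fun z => ((((1 - ‖w‖ ^ 2) / ‖z - w‖ ^ 2 : ℝ)) : ℂ)) 0 1 =
      ((Real.circleAverage (fun z => (1 - ‖w‖ ^ 2) / ‖z - w‖ ^ 2) 0 1 : ℝ) : ℂ) := by
    simp only [Real.circleAverage_def, intervalIntegral.integral_ofReal]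
    simp
  rw [h4] at h3
  exact_mod_cast h3

open Topology Asymptotics in
lemma hk_fatou_local {G : ℂ → ℂ} (hG : DiffContOnCl ℂ G (Metric.ball 0 1))
    (ho : G =o[𝓝[Metric.sphere 0 1] 1] (fun w => w - 1)) :
    Tendsto (fun r : ℝ => deriv G r) (𝓝[<] 1) (𝓝 0) := by
  have hcG : ContinuousOn G (Metric.closedBall 0 1) := hG.continuousOn_ball
  obtain ⟨M, hM⟩ := (isCompact_closedBall (0:ℂ) 1).exists_bound_of_continuousOn hcG
  have key : ∀ ε > 0, ∃ K ≥ 0, ∀ r : ℝ, 0 < r → r < 1 → ‖deriv G r‖ ≤ 16 * ε + 64 * K * (1 - r) := by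
    intro ε hε
    have h1 := ho.bound hε
    rw [eventually_nhdsWithin_iff, Metric.eventually_nhds_iff] at h1
    obtain ⟨η, hη, h1⟩ := h1
    have hM0 : 0 ≤ M := (norm_nonneg _).trans (hM 0 (by simp))
    refine ⟨M / η ^ 3, by positivity, fun r hr0 hr1 => ?_⟩
    have hb : ∀ w : ℂ, ‖w‖ = 1 → ‖(((w - r) ^ 2)⁻¹ - ((1 - r * w) ^ 2)⁻¹) * G w‖ ≤
      16 * ε * ((1 - r ^ 2) / ‖w - r‖ ^ 2) + 64 * (M / η ^ 3) * (1 - r) := by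
      intro w hw
      refine hk_kernel_bound hr0 hr1 hε.le (by positivity) hw ?_
      by_cases hd : ‖w - 1‖ < η
      · have := h1 (by simpa [dist_eq_norm] using hd) (by simpa using hw)
        have h' : 0 ≤ M / η ^ 3 * ‖w - 1‖ ^ 3 := by positivity
        linarith
      · push Not at hd
        have h2 := hM w (by simp [hw])
        have h3 : M ≤ M / η ^ 3 * ‖w - 1‖ ^ 3 := by
          rw [div_mul_eq_mul_div, le_div_iff₀ (by positivity)]
          gcongr
        have h' : 0 ≤ ε * ‖w - 1‖ := by positivity
        linarith
    have hform := hk_kernel_formula hG hr0 hr1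
    have hP := hk_poisson_one (w := (r : ℂ)) (by simp [abs_of_pos hr0, hr1])
    rw [Complex.norm_of_nonneg hr0.le] at hP
    have hne2 : ∀ θ : ℝ, ‖circleMap 0 1 θ - (r : ℂ)‖ ≠ 0 := by
      intro θ h
      rw [norm_eq_zero, sub_eq_zero] at h
      have := congrArg norm h
      rw [norm_circleMap_zero, Complex.norm_of_nonneg hr0.le] at this
      simp at this; linarith
    have hcont : Continuous (fun θ : ℝ => (1 - r ^ 2) / ‖circleMap 0 1 θ - (r : ℂ)‖ ^ 2) := by
      refine Continuous.div (by fun_prop) (by fun_prop) (fun θ => pow_ne_zero 2 (hne2 θ))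
    have hI : ‖∮ w in C(0, 1), (((w - r) ^ 2)⁻¹ - ((1 - r * w) ^ 2)⁻¹) * G w‖ ≤
        2 * Real.pi * (16 * ε + 64 * (M / η ^ 3) * (1 - r)) := by
      rw [circleIntegral]
      have h2pi : (0:ℝ) ≤ 2 * Real.pi := by positivity
      calc _ ≤ ∫ θ in (0:ℝ)..2 * Real.pi, (16 * ε * ((1 - r ^ 2) / ‖circleMap 0 1 θ - (r : ℂ)‖ ^ 2) + 64 * (M / η ^ 3) * (1 - r)) := by
            refine intervalIntegral.norm_integral_le_of_norm_le h2pi ?_ ?_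
            · refine ae_of_all _ fun θ _ => ?_
              rw [norm_smul]
              have : ‖deriv (circleMap 0 1) θ‖ = 1 := by simp
              rw [this, one_mul]
              exact hb _ (by simp)
            · exact (Continuous.intervalIntegrable (by fun_prop) _ _)
        _ = _ := by
            rw [intervalIntegral.integral_add, intervalIntegral.integral_const_mul]
            · have : ∫ θ in (0:ℝ)..2 * Real.pi, ((1 - r ^ 2) / ‖circleMap 0 1 θ - (r : ℂ)‖ ^ 2) = 2 * Real.pi := by
                rw [Real.circleAverage_def, smul_eq_mul] at hP
                field_simp at hP
                linarith
              rw [this]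
              simp
              ring
            · exact (Continuous.intervalIntegrable (by fun_prop) _ _)
            · exact (Continuous.intervalIntegrable (by fun_prop) _ _)
    rw [hform, norm_mul] at hI
    have : ‖(2 * Real.pi * I : ℂ)‖ = 2 * Real.pi := by simp [abs_of_pos Real.pi_pos]
    rw [this] at hI
    exact le_of_mul_le_mul_left hI (by positivity)
  rw [Metric.tendsto_nhds]
  intro ε hε
  obtain ⟨K, hK, hb⟩ := key (ε / 32) (by positivity)
  have ht : Tendsto (fun r : ℝ => 64 * K * (1 - r)) (𝓝[<] 1) (𝓝 0) := by
    have : Continuous (fun r : ℝ => 64 * K * (1 - r)) := by fun_prop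
    have := this.tendsto 1
    simp only [sub_self, mul_zero] at this
    exact this.mono_left nhdsWithin_le_nhds
  have h2 := ht.eventually (gt_mem_nhds (show (0:ℝ) < ε / 2 by positivity))
  have h3 : ∀ᶠ r : ℝ in 𝓝[<] 1, 0 < r ∧ r < 1 := by
    filter_upwards [Ioo_mem_nhdsLT (show (0:ℝ) < 1 by norm_num)] with r hr using hr
  filter_upwards [h2, h3] with r hr hr'
  rw [dist_zero_right]
  have := hb r hr'.1 hr'.2
  linarith

lemma hk_set_integral [Fact (0 < 2 * Real.pi)] (f : AddCircle (2 * Real.pi) → ℂ) {θ : ℝ}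
    (h0 : 0 ≤ θ) (h1 : θ ≤ 2 * Real.pi) :
    ∫ x in (AddCircle.measurableEquivIoc (2 * Real.pi) 0) ⁻¹' (Subtype.val ⁻¹' Ioc 0 θ),
      f x ∂(AddCircle.haarAddCircle) = ((2 * Real.pi)⁻¹ : ℝ) • ∫ t in (0:ℝ)..θ, f (t : AddCircle (2 * Real.pi)) := by
  have hms : MeasurableSet ((AddCircle.measurableEquivIoc (2 * Real.pi) 0) ⁻¹' (Subtype.val ⁻¹' Ioc 0 θ)) :=
    (AddCircle.measurableEquivIoc (2 * Real.pi) 0).measurable (measurable_subtype_coe measurableSet_Ioc)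
  rw [← integral_indicator hms, AddCircle.integral_haarAddCircle, ← AddCircle.integral_preimage _ 0,
    intervalIntegral.integral_of_le h0, ← integral_indicator measurableSet_Ioc]
  congr 1
  rw [← integral_indicator measurableSet_Ioc]
  congr 1
  funext t
  by_cases ht : t ∈ Ioc (0:ℝ) (0 + 2 * Real.pi)
  · rw [indicator_of_mem ht]
    have e : ((AddCircle.measurableEquivIoc (2 * Real.pi) 0) (t : AddCircle (2 * Real.pi)) : ℝ) = t :=
      AddCircle.equivIoc_coe_of_mem ht
    by_cases h : t ∈ Ioc 0 θ
    · rw [indicator_of_mem h, indicator_of_mem (by simpa [e] using h)]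
    · rw [indicator_of_notMem h, indicator_of_notMem (by simpa only [mem_preimage, e] using h)]
  · rw [indicator_of_notMem ht, indicator_of_notMem]
    intro h
    exact ht ⟨h.1, by linarith [h.2]⟩

lemma hasSum_congr_eq {f g : ℕ → ℂ} {a b : ℂ} (h : HasSum f a) (h1 : f = g) (h2 : a = b) :
    HasSum g b := by rw [← h1, ← h2]; exact h

lemma hk_bdry_exists {c : ℕ → ℂ} (hc : Summable fun k => ‖c k‖ ^ 2) :
    ∃ F : ℝ → ℂ, IntervalIntegrable F volume 0 (2 * Real.pi) ∧
      IntegrableOn (fun t => ‖F t‖ ^ 2) (Ioc 0 (2 * Real.pi)) ∧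
      ∫ t in Ioc 0 (2 * Real.pi), ‖F t‖ ^ 2 = 2 * Real.pi * ∑' k, ‖c k‖ ^ 2 ∧
      ∀ θ ∈ Icc 0 (2 * Real.pi), HasSum (fun k : ℕ => c k / (k + 1) *
        (exp (θ * I) ^ (k + 1) - 1)) (I * ∫ t in (0:ℝ)..θ, F t) := by
  have : Fact (0 < 2 * Real.pi) := ⟨Real.two_pi_pos⟩
  have hpi := Real.pi_pos
  have h2pi : (0:ℝ) ≤ 2 * Real.pi := by positivity
  let e : ℕ → ℤ := fun k => (k : ℤ) + 1
  have he : Function.Injective e := fun a b h => by simpa [e] using h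
  let d : ℤ → ℂ := Function.extend e c 0
  have hd : ∀ k, d (e k) = c k := fun k => he.extend_apply _ _ _
  have hd0 : ∀ j, j ∉ range e → d j = 0 := fun j hj => by
    have := Function.extend_apply' (f := e) c (0 : ℤ → ℂ) j (by simpa using hj)
    simpa [d] using this
  have hsum : HasSum (fun j => ‖d j‖ ^ 2) (∑' k, ‖c k‖ ^ 2) := by
    rw [← he.hasSum_iff (fun j hj => by rw [hd0 j hj]; simp)]
    simpa [Function.comp_def, hd] using hc.hasSum
  have hmem : Memℓp d 2 := by
    refine memℓp_gen ?_
    have := hsum.summable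
    simpa using this
  let D : lp (fun _ : ℤ => ℂ) 2 := ⟨d, hmem⟩
  let F := (fourierBasis (T := 2 * Real.pi)).repr.symm D
  have hF : ∀ j, fourierCoeff F j = d j := fun j => by
    rw [← fourierBasis_repr]; simp [F, D]
  have hmemF := Lp.memLp F
  rw [memLp_haarAddCircle_iff] at hmemF
  have hmp := AddCircle.measurePreserving_mk (2 * Real.pi) 0
  have hmemF2 : MemLp (fun t : ℝ => F (t : AddCircle (2 * Real.pi))) 2 (volume.restrict (Ioc 0 (0 + 2 * Real.pi))) :=
    hmemF.comp_measurePreserving hmp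
  rw [zero_add] at hmemF2
  refine ⟨fun t => F (t : AddCircle (2 * Real.pi)), ?_, ?_, ?_, ?_⟩
  · rw [intervalIntegrable_iff_integrableOn_Ioc_of_le h2pi]
    exact hmemF2.integrable (by norm_num)
  · exact hmemF2.integrable_norm_pow (by norm_num)
  · have h1 := tsum_sq_fourierCoeff F
    rw [AddCircle.integral_haarAddCircle, ← AddCircle.integral_preimage _ 0, zero_add] at h1
    simp only [hF] at h1
    rw [hsum.tsum_eq] at h1
    rw [h1, smul_eq_mul]
    field_simp
  · intro θ hθ
    have hms : MeasurableSet ((AddCircle.measurableEquivIoc (2 * Real.pi) 0) ⁻¹' (Subtype.val ⁻¹' Ioc 0 θ)) :=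
      (AddCircle.measurableEquivIoc (2 * Real.pi) 0).measurable (measurable_subtype_coe measurableSet_Ioc)
    have hs := (fourierBasis (T := 2 * Real.pi)).hasSum_inner_mul_inner
      (indicatorConstLp 2 hms (measure_ne_top _ _) (1 : ℂ)) F
    have hin : ∀ j : ℤ, inner ℂ (fourierLp (T := 2 * Real.pi) 2 j) F = d j := fun j => by
      rw [← hF, ← fourierBasis_repr, HilbertBasis.repr_apply_apply, coe_fourierBasis]
    simp only [L2.inner_indicatorConstLp_one, coe_fourierBasis, hin] at hs
    rw [hk_set_integral _ hθ.1 hθ.2] at hs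
    have hintg : ∀ j : ℤ, ∫ x in (AddCircle.measurableEquivIoc (2 * Real.pi) 0) ⁻¹' (Subtype.val ⁻¹' Ioc 0 θ),
        (fourierLp (T := 2 * Real.pi) 2 j) x ∂(AddCircle.haarAddCircle) =
        ((2 * Real.pi)⁻¹ : ℝ) • ∫ t in (0:ℝ)..θ, exp (j * I * t) := by
      intro j
      rw [integral_congr_ae (ae_restrict_of_ae (coeFn_fourierLp 2 j)), hk_set_integral _ hθ.1 hθ.2]
      congr 2
      funext t
      rw [fourier_coe_apply]
      congr 1
      push_cast
      field_simp
    simp only [hintg] at hs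
    rw [← he.hasSum_iff (fun j hj => by rw [hd0 j hj]; simp)] at hs
    have hs2 := hs.mul_left ((2 * Real.pi : ℂ) * I)
    refine (hasSum_congr_eq hs2 ?_ ?_)
    · funext k
      simp only [Function.comp, hd]
      have hk : ((e k : ℤ) : ℂ) = k + 1 := by simp [e]
      have hk0 : (k : ℂ) + 1 ≠ 0 := by exact_mod_cast Nat.succ_ne_zero k
      rw [hk, integral_exp_mul_complex (mul_ne_zero hk0 I_ne_zero), ← Complex.exp_nat_mul]
      simp only [Complex.real_smul]
      push_cast
      rw [show (k + 1 : ℂ) * I * θ = (k + 1) * (θ * I) by ring]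
      simp
      field_simp
    · simp only [Complex.real_smul]
      push_cast
      field_simp

lemma hk_prim_summable {c : ℕ → ℂ} (hc : Summable fun k => ‖c k‖ ^ 2) :
    Summable fun k : ℕ => ‖c k / (k + 1)‖ := by
  have h2 : Summable fun k : ℕ => (1 : ℝ) / ((k : ℝ) + 1) ^ 2 := by
    have := (summable_nat_add_iff 1).2 (Real.summable_one_div_nat_pow.2 (show 1 < 2 by norm_num))
    simpa using this
  refine Summable.of_nonneg_of_le (fun _ => norm_nonneg _) (fun k => ?_) (hc.add h2)
  have h : ‖(k : ℂ) + 1‖ = (k : ℝ) + 1 := by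
    have : ((k : ℂ) + 1) = (((k : ℝ) + 1 : ℝ) : ℂ) := by push_cast; rfl
    rw [this, Complex.norm_of_nonneg (by positivity)]
  rw [norm_div, h, div_eq_mul_one_div, ← one_div_pow]
  nlinarith [sq_nonneg (‖c k‖ - 1 / ((k : ℝ) + 1)), sq_nonneg (‖c k‖ + 1 / ((k : ℝ) + 1))]

/-- The primitive of the power series with coefficients `c`. -/
def hkPrim (c : ℕ → ℂ) (z : ℂ) : ℂ := ∑' k : ℕ, c k / (k + 1) * z ^ (k + 1)

lemma hk_prim_term_le {c : ℕ → ℂ} {z : ℂ} (hz : ‖z‖ ≤ 1) (k : ℕ) :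
    ‖c k / (k + 1) * z ^ (k + 1)‖ ≤ ‖c k / (k + 1)‖ := by
  rw [norm_mul, norm_pow]
  exact mul_le_of_le_one_right (norm_nonneg _) (pow_le_one₀ (norm_nonneg _) hz)

lemma hk_prim_diffCont {c : ℕ → ℂ} (hc : Summable fun k => ‖c k‖ ^ 2) :
    DiffContOnCl ℂ (hkPrim c) (Metric.ball 0 1) := by
  have hs := hk_prim_summable hc
  refine DiffContOnCl.mk_ball ?_ ?_
  · refine differentiableOn_tsum_of_summable_norm hs (fun k => by fun_prop) Metric.isOpen_ball ?_
    intro k z hz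
    exact hk_prim_term_le (by simpa using (Metric.ball_subset_closedBall hz)) k
  · refine continuousOn_tsum (fun k => by fun_prop) hs ?_
    intro k z hz
    exact hk_prim_term_le (by simpa using hz) k

lemma hk_prim_deriv {f : ℂ → ℂ} (hf : MemH2 f) {z : ℂ} (hz : z ∈ Metric.ball (0:ℂ) 1) :
    deriv (hkPrim (taylorCoeff f)) z = f z := by
  have hs := hk_prim_summable hf.2
  have h := hasSum_deriv_of_summable_norm (F := fun (k : ℕ) z => taylorCoeff f k / (k + 1) * z ^ (k + 1))
    hs (fun k => by fun_prop) Metric.isOpen_ball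
    (fun k z hz => hk_prim_term_le (by simpa using (Metric.ball_subset_closedBall hz)) k) hz
  have h2 := hk_hasSum hf.1 (z := z) hz
  refine (h.unique ?_)
  refine hasSum_congr_eq h2 (funext fun k => ?_) rfl
  have hk0 : (k : ℂ) + 1 ≠ 0 := by exact_mod_cast Nat.succ_ne_zero k
  simp
  field_simp

open Topology Asymptotics in
lemma hk_fatou_point {G : ℂ → ℂ} (hG : DiffContOnCl ℂ G (Metric.ball 0 1)) {θ : ℝ} {D : ℂ}
    (hD : HasDerivAt (fun t : ℝ => G (exp (t * I))) D θ) :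
    Tendsto (fun r : ℝ => deriv G (r * exp (θ * I))) (𝓝[<] 1) (𝓝 (D / I / exp (θ * I))) := by
  set ζ := exp (θ * I) with hζ
  have hζn : ‖ζ‖ = 1 := norm_exp_ofReal_mul_I θ
  have hζ0 : ζ ≠ 0 := exp_ne_zero _
  set L := D / I / ζ with hL
  let G1 : ℂ → ℂ := fun z => (G (ζ * z) - G ζ) / ζ - L * (z - 1)
  have hmaps : MapsTo (fun z => ζ * z) (Metric.ball (0:ℂ) 1) (Metric.ball 0 1) := by
    intro z hz; simpa [hζn] using hz
  have hcomp : DiffContOnCl ℂ (fun z => G (ζ * z)) (Metric.ball 0 1) :=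
    hG.comp (g := fun z => ζ * z) (Differentiable.diffContOnCl (by fun_prop)) hmaps
  have hG1 : DiffContOnCl ℂ G1 (Metric.ball 0 1) := by
    have h1 : DiffContOnCl ℂ (fun z => ζ⁻¹ • (G (ζ * z) - G ζ)) (Metric.ball 0 1) :=
      (hcomp.sub_const (G ζ)).const_smul ζ⁻¹
    have h2 : DiffContOnCl ℂ (fun z => L * (z - 1)) (Metric.ball 0 1) :=
      Differentiable.diffContOnCl (by fun_prop)
    have h3 := h1.sub h2
    convert h3 using 1
    funext z
    simp only [G1, Pi.sub_apply, smul_eq_mul]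
    ring
  -- little-o
  have harg0 : Tendsto arg (𝓝[Metric.sphere 0 1] (1:ℂ)) (𝓝 0) := by
    have := (continuousAt_arg (x := 1) (by simp)).tendsto
    rw [arg_one] at this
    exact this.mono_left nhdsWithin_le_nhds
  have hlog := (hasStrictDerivAt_log (x := 1) (by simp)).hasDerivAt
  rw [hasDerivAt_iff_isLittleO] at hlog
  have hlog' : (fun w : ℂ => log w - (w - 1)) =o[𝓝[Metric.sphere 0 1] (1:ℂ)] (fun w => w - 1) := by
    refine (hlog.mono nhdsWithin_le_nhds).congr_left fun w => ?_
    simp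
  have hlogO : (fun w : ℂ => log w) =O[𝓝[Metric.sphere 0 1] (1:ℂ)] (fun w => w - 1) := by
    have := hlog'.isBigO.add (isBigO_refl (fun w : ℂ => w - 1) _)
    refine this.congr_left fun w => by ring
  have hlogarg : ∀ w : ℂ, ‖w‖ = 1 → log w = arg w * I := by
    intro w hw
    simp [log, hw]
  have hargO : arg =O[𝓝[Metric.sphere 0 1] (1:ℂ)] (fun w : ℂ => w - 1) := by
    refine IsBigO.trans ?_ hlogO
    refine IsBigO.of_bound 1 ?_
    filter_upwards [self_mem_nhdsWithin] with w hw
    rw [hlogarg w (by simpa using hw)]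
    simp
  rw [hasDerivAt_iff_isLittleO_nhds_zero] at hD
  have hD2 := (hD.comp_tendsto harg0).trans_isBigO hargO
  have ho : G1 =o[𝓝[Metric.sphere 0 1] 1] (fun w => w - 1) := by
    have h3 := (hD2.const_mul_left ζ⁻¹).add (hlog'.const_mul_left L)
    refine h3.congr' ?_ (EventuallyEq.refl _ _)
    filter_upwards [self_mem_nhdsWithin] with w hw
    have hw1 : ‖w‖ = 1 := by simpa using hw
    have hwe : exp (arg w * I) = w := by
      have := norm_mul_exp_arg_mul_I w
      rw [hw1] at this; simpa using this
    simp only [Function.comp, G1]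
    have : exp ((θ + arg w : ℝ) * I) = ζ * w := by
      push_cast
      rw [add_mul, exp_add, hwe]
    rw [this, ← hζ, hlogarg w hw1]
    simp only [real_smul, hL]
    field_simp
    ring
  have ht := hk_fatou_local hG1 ho
  have hder : ∀ r : ℝ, 0 < r → r < 1 → deriv G1 r = deriv G (r * ζ) - L := by
    intro r h0 h1
    have hr : ζ * (r : ℂ) ∈ Metric.ball (0:ℂ) 1 := by simp [hζn, abs_of_pos h0, h1]
    have hd := (hG.differentiableAt Metric.isOpen_ball hr).hasDerivAt
    have e1 : HasDerivAt (fun z : ℂ => ζ * z) ζ (r : ℂ) := by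
      simpa using (hasDerivAt_id (r : ℂ)).const_mul ζ
    have h2 := hd.comp (r : ℂ) e1
    have h3 : HasDerivAt G1 (deriv G (ζ * r) * ζ / ζ - L * 1) (r : ℂ) :=
      ((h2.sub_const (G ζ)).div_const ζ).sub (((hasDerivAt_id (r : ℂ)).sub_const 1).const_mul L)
    rw [h3.deriv, mul_comm ζ (r : ℂ)]
    field_simp
  have ht2 := ht.add_const L
  rw [zero_add] at ht2
  refine ht2.congr' ?_
  filter_upwards [Ioo_mem_nhdsLT (show (0:ℝ) < 1 by norm_num)] with r hr
  rw [hder r hr.1 hr.2]; ring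

open Topology in
/-- Fatou's theorem and Parseval's identity for the Hardy space. -/
lemma hk_fatou {f : ℂ → ℂ} (hf : MemH2 f) :
    (∀ᵐ (θ : ℝ) ∂(volume.restrict (Ioc (0:ℝ) (2 * Real.pi))),
      Tendsto (fun r : ℝ => f (r * exp (θ * I))) (𝓝[<] 1) (𝓝 (bdryVal f (exp (θ * I))))) ∧
    IntegrableOn (fun θ : ℝ => ‖bdryVal f (exp (θ * I))‖ ^ 2) (Ioc 0 (2 * Real.pi)) ∧
    ∫ θ in Ioc (0:ℝ) (2 * Real.pi), ‖bdryVal f (exp (θ * I))‖ ^ 2 = 2 * Real.pi * h2NormSq f := by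
  have h2pi : (0:ℝ) ≤ 2 * Real.pi := by positivity
  obtain ⟨F, hF1, hF2, hF3, hF4⟩ := hk_bdry_exists hf.2
  have hs := hk_prim_summable hf.2
  have hGs : ∀ z : ℂ, ‖z‖ ≤ 1 → HasSum (fun k : ℕ => taylorCoeff f k / (k + 1) * z ^ (k + 1))
      (hkPrim (taylorCoeff f) z) := fun z hz =>
    (Summable.of_norm_bounded hs (fun k => hk_prim_term_le hz k)).hasSum
  have hGe : ∀ θ ∈ Icc 0 (2 * Real.pi), hkPrim (taylorCoeff f) (exp (θ * I)) =
      I * (∫ t in (0:ℝ)..θ, F t) + hkPrim (taylorCoeff f) 1 := by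
    intro θ hθ
    have h1 := (hGs (exp (θ * I)) (norm_exp_ofReal_mul_I θ).le).sub (hGs 1 (by simp))
    have h2 := hF4 θ hθ
    have h3 := h1.unique (by
      refine hasSum_congr_eq h2 (funext fun k => ?_) rfl
      simp only [one_pow]; ring)
    rw [← h3]; ring
  have key : ∀ᵐ (θ : ℝ) ∂(volume.restrict (Ioc (0:ℝ) (2 * Real.pi))),
      Tendsto (fun r : ℝ => f (r * exp (θ * I))) (𝓝[<] 1) (𝓝 (F θ / exp (θ * I))) := by
    have h1 := hF1.ae_hasDerivAt_integral
    have h2 : ∀ᵐ θ : ℝ, θ ≠ 2 * Real.pi := by simp [ae_iff, measure_singleton]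
    rw [ae_restrict_iff' measurableSet_Ioc]
    filter_upwards [h1, h2] with θ h1 h2 hθ
    have hθ' : θ ∈ Ioo 0 (2 * Real.pi) := ⟨hθ.1, lt_of_le_of_ne hθ.2 h2⟩
    rw [uIcc_of_le h2pi] at h1
    have hd := h1 (Ioc_subset_Icc_self hθ) 0 (by simp [h2pi])
    have hd2 : HasDerivAt (fun t : ℝ => hkPrim (taylorCoeff f) (exp (t * I))) (I * F θ) θ := by
      refine ((hd.const_mul I).add_const (hkPrim (taylorCoeff f) 1)).congr_of_eventuallyEq ?_
      filter_upwards [Ioo_mem_nhds hθ'.1 hθ'.2] with t ht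
      exact hGe t (Ioo_subset_Icc_self ht)
    have h3 := hk_fatou_point (hk_prim_diffCont hf.2) hd2
    rw [mul_div_cancel_left₀ _ I_ne_zero] at h3
    refine h3.congr' ?_
    filter_upwards [Ioo_mem_nhdsLT (show (0:ℝ) < 1 by norm_num)] with r hr
    exact hk_prim_deriv hf (by simp [norm_exp_ofReal_mul_I, abs_of_pos hr.1, hr.2])
  have hbd : ∀ᵐ (θ : ℝ) ∂(volume.restrict (Ioc (0:ℝ) (2 * Real.pi))),
      bdryVal f (exp (θ * I)) = F θ / exp (θ * I) := by
    filter_upwards [key] with θ h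
    exact h.limUnder_eq
  have hn : ∀ᵐ (θ : ℝ) ∂(volume.restrict (Ioc (0:ℝ) (2 * Real.pi))),
      ‖F θ‖ ^ 2 = ‖bdryVal f (exp (θ * I))‖ ^ 2 := by
    filter_upwards [hbd] with θ h
    rw [h, norm_div, norm_exp_ofReal_mul_I, div_one]
  refine ⟨?_, ?_, ?_⟩
  · filter_upwards [key, hbd] with θ h h'
    rw [h']; exact h
  · exact hF2.congr hn
  · rw [← integral_congr_ae hn, hF3]; rfl

/-- The square integral of `F` over the circle of radius `r`. -/
def cavg (F : ℂ → ℂ) (r : ℝ) : ℝ := ∫ θ in Ioc (0:ℝ) (2 * Real.pi), ‖F (r * exp (θ * I))‖ ^ 2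

lemma hk_mem_circle {r : ℝ} (h0 : 0 ≤ r) (h1 : r < 1) (θ : ℝ) : (r : ℂ) * exp (θ * I) ∈ unitDisk := by
  simp [unitDisk, norm_exp_ofReal_mul_I, abs_of_nonneg h0, h1]

lemma hk_circle_cont {F : ℂ → ℂ} (hF : ContinuousOn F unitDisk) {r : ℝ} (h0 : 0 ≤ r) (h1 : r < 1) :
    Continuous fun θ : ℝ => F (r * exp (θ * I)) :=
  hF.comp_continuous (by fun_prop) (hk_mem_circle h0 h1)

lemma hk_circle_int {F : ℂ → ℂ} (hF : ContinuousOn F unitDisk) {r : ℝ} (h0 : 0 ≤ r) (h1 : r < 1) :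
    IntegrableOn (fun θ : ℝ => ‖F (r * exp (θ * I))‖ ^ 2) (Ioc 0 (2 * Real.pi)) :=
  (((hk_circle_cont hF h0 h1).norm.pow 2).integrableOn_Icc).mono_set Ioc_subset_Icc_self

open Topology in
lemma hk_parseval {F : ℂ → ℂ} (hF : DifferentiableOn ℂ F unitDisk) {r : ℝ} (h0 : 0 ≤ r) (h1 : r < 1) :
    HasSum (fun k => ‖taylorCoeff F k‖ ^ 2 * r ^ (2 * k)) (cavg F r / (2 * Real.pi)) := by
  have hr : (r : ℂ) ∈ unitDisk := by simp [unitDisk, abs_of_nonneg h0, h1]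
  have hsum := (hk_hasSum hF hr).summable.norm
  have hsq : Summable (fun k => ‖taylorCoeff F k * (r : ℂ) ^ k‖ ^ 2) := by
    obtain ⟨B, hB⟩ : ∃ B, ∀ k, ‖taylorCoeff F k * (r : ℂ) ^ k‖ ≤ B :=
      ⟨_, fun k => hsum.le_tsum k (fun _ _ => norm_nonneg _)⟩
    refine Summable.of_nonneg_of_le (fun _ => by positivity) (fun k => ?_) (hsum.mul_left B)
    rw [pow_two]
    exact mul_le_mul_of_nonneg_right (hB k) (norm_nonneg _)
  have hz : ∀ z ∈ unitDisk, (r : ℂ) * z ∈ unitDisk := by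
    intro z hz
    have : ‖z‖ < 1 := by simpa [unitDisk] using hz
    simp only [unitDisk, Metric.mem_ball, dist_zero_right, norm_mul, Complex.norm_of_nonneg h0]
    nlinarith [norm_nonneg z]
  have hs : ∀ z ∈ unitDisk, HasSum (fun k => (taylorCoeff F k * (r : ℂ) ^ k) * z ^ k) (F (r * z)) := by
    intro z hz'
    refine hasSum_congr_eq (hk_hasSum hF (hz z hz')) (funext fun k => ?_) rfl
    rw [mul_pow]; ring
  have hco := hk_coeff (f := fun z => F (r * z)) hs
  have hm : MemH2 (fun z => F (r * z)) := ⟨hk_differentiableOn hs, by simpa only [hco] using hsq⟩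
  have hp := (hk_fatou hm).2.2
  have hb : ∀ θ : ℝ, bdryVal (fun z => F (r * z)) (exp (θ * I)) = F (r * exp (θ * I)) := by
    intro θ
    refine Tendsto.limUnder_eq ?_
    have hca : ContinuousAt F (r * exp (θ * I)) :=
      hF.continuousOn.continuousAt (Metric.isOpen_ball.mem_nhds (hk_mem_circle h0 h1 θ))
    have h2 : Tendsto (fun s : ℝ => (r : ℂ) * (s * exp (θ * I))) (𝓝[<] 1) (𝓝 (r * exp (θ * I))) := by
      have : Continuous (fun s : ℝ => (r : ℂ) * (s * exp (θ * I))) := by fun_prop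
      have := this.tendsto 1
      simp only [ofReal_one, one_mul] at this
      exact this.mono_left nhdsWithin_le_nhds
    exact hca.tendsto.comp h2
  simp only [hb] at hp
  have he : ∀ k, ‖taylorCoeff F k‖ ^ 2 * r ^ (2 * k) = ‖taylorCoeff F k * (r : ℂ) ^ k‖ ^ 2 := by
    intro k
    rw [norm_mul, norm_pow, Complex.norm_of_nonneg h0]; ring
  have : cavg F r / (2 * Real.pi) = ∑' k, ‖taylorCoeff F k * (r : ℂ) ^ k‖ ^ 2 := by
    rw [cavg, hp, mul_div_cancel_left₀ _ (by positivity)]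
    simp only [h2NormSq, hco]
  rw [this]
  simp only [he]
  exact hsq.hasSum

lemma hk_cavg_le {F : ℂ → ℂ} (hF : MemH2 F) {r : ℝ} (h0 : 0 ≤ r) (h1 : r < 1) :
    cavg F r ≤ 2 * Real.pi * h2NormSq F := by
  have h := hk_parseval hF.1 h0 h1
  have h2 := hasSum_le (fun k => ?_) h hF.2.hasSum
  · rw [div_le_iff₀ (by positivity)] at h2
    rw [mul_comm]; exact h2
  · exact mul_le_of_le_one_right (by positivity) (pow_le_one₀ h0 h1.le)

open Topology in
lemma hk_dom {F : ℂ → ℂ} (hF : DifferentiableOn ℂ F unitDisk) {B : ℝ} {r0 : ℝ} (hr0 : r0 < 1)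
    (h : ∀ r : ℝ, r0 ≤ r → 0 ≤ r → r < 1 → cavg F r ≤ 2 * Real.pi * B) :
    MemH2 F ∧ h2NormSq F ≤ B := by
  have hb : ∀ n, ∑ k ∈ Finset.range n, ‖taylorCoeff F k‖ ^ 2 ≤ B := by
    intro n
    have ht : Tendsto (fun r : ℝ => ∑ k ∈ Finset.range n, ‖taylorCoeff F k‖ ^ 2 * r ^ (2 * k)) (𝓝[<] 1)
        (𝓝 (∑ k ∈ Finset.range n, ‖taylorCoeff F k‖ ^ 2)) := by
      have : Continuous (fun r : ℝ => ∑ k ∈ Finset.range n, ‖taylorCoeff F k‖ ^ 2 * r ^ (2 * k)) := by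
        fun_prop
      have := this.tendsto 1
      simp only [one_pow, mul_one] at this
      exact this.mono_left nhdsWithin_le_nhds
    refine le_of_tendsto ht ?_
    filter_upwards [Ioo_mem_nhdsLT (show max r0 0 < 1 by simp [hr0])] with r hr
    have hr1 : 0 ≤ r := (le_max_right r0 0).trans hr.1.le
    have hr2 : r0 ≤ r := (le_max_left r0 0).trans hr.1.le
    have hp := hk_parseval hF hr1 hr.2
    refine (sum_le_hasSum _ (fun k _ => by positivity) hp).trans ?_
    rw [div_le_iff₀ (by positivity), mul_comm]
    exact h r hr2 hr1 hr.2
  exact ⟨⟨hF, summable_of_sum_range_le (fun _ => by positivity) hb⟩,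
    Real.tsum_le_of_sum_range_le (fun _ => by positivity) hb⟩

lemma hk_mul_bdd {f F : ℂ → ℂ} (hf : DifferentiableOn ℂ f unitDisk) (hF : MemH2 F) {C : ℝ}
    {r0 : ℝ} (hr0 : r0 < 1) (h : ∀ z ∈ unitDisk, r0 ≤ ‖z‖ → ‖f z‖ ≤ C * ‖F z‖) :
    MemH2 f ∧ h2NormSq f ≤ C ^ 2 * h2NormSq F := by
  refine hk_dom hf hr0 fun r hr hr1 hr2 => ?_
  have h1 : cavg f r ≤ C ^ 2 * cavg F r := by
    rw [cavg, cavg, ← integral_const_mul]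
    refine integral_mono (hk_circle_int hf.continuousOn hr1 hr2)
      ((hk_circle_int hF.1.continuousOn hr1 hr2).const_mul _) fun θ => ?_
    have h2 := h _ (hk_mem_circle hr1 hr2 θ) (by
      simp [norm_exp_ofReal_mul_I]; exact hr.trans (le_abs_self r))
    simp only
    rw [← mul_pow]
    gcongr
  have h2 := hk_cavg_le hF hr1 hr2
  calc _ ≤ _ := h1
    _ ≤ C ^ 2 * (2 * Real.pi * h2NormSq F) := by gcongr
    _ = _ := by ring

lemma hk_growth_young {g : ℂ → ℂ} (hg : MemH2 g) {z : ℂ} (hz : z ∈ unitDisk) {t : ℝ} (ht : 0 < t) :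
    2 * ‖g z‖ ≤ t * h2NormSq g + (t * (1 - ‖z‖ ^ 2))⁻¹ := by
  have hz' : ‖z‖ < 1 := by simpa [unitDisk] using hz
  have hs := hk_hasSum hg.1 hz
  have hgeo := hasSum_geometric_of_lt_one (r := ‖z‖ ^ 2) (by positivity) (by nlinarith [norm_nonneg z])
  have h1 := (hg.2.hasSum.mul_left t).add (hgeo.mul_left t⁻¹)
  have h2 : ‖g z‖ ≤ ∑' k, ‖taylorCoeff g k * z ^ k‖ := by
    rw [← hs.tsum_eq]; exact norm_tsum_le_tsum_norm hs.summable.norm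
  have h3 := hasSum_le (fun k => ?_) (hs.summable.norm.hasSum.mul_left 2) h1
  · rw [mul_inv]
    change _ ≤ t * h2NormSq g + _ at h3
    linarith
  · rw [norm_mul, norm_pow, ← pow_mul, mul_comm 2 k, pow_mul]
    set a := ‖taylorCoeff g k‖
    set b := ‖z‖ ^ k
    have : t * a ^ 2 + t⁻¹ * b ^ 2 - 2 * (a * b) = t⁻¹ * (t * a - b) ^ 2 := by
      field_simp; ring
    have h5 : 0 ≤ t⁻¹ * (t * a - b) ^ 2 := by positivity
    linarith

lemma hk_growth {g : ℂ → ℂ} (hg : MemH2 g) {z : ℂ} (hz : z ∈ unitDisk) :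
    ‖g z‖ ^ 2 ≤ h2NormSq g / (1 - ‖z‖ ^ 2) := by
  have hz' : ‖z‖ < 1 := by simpa [unitDisk] using hz
  have hd : 0 < 1 - ‖z‖ ^ 2 := by nlinarith [norm_nonneg z]
  rcases eq_or_ne (g z) 0 with h | h
  · rw [h]; simp; exact div_nonneg (hk_nonneg g) hd.le
  have hg0 : 0 < ‖g z‖ := norm_pos_iff.2 h
  have h2 := hk_growth_young hg hz (t := (‖g z‖ * (1 - ‖z‖ ^ 2))⁻¹) (by positivity)
  rw [le_div_iff₀ hd]
  set a := ‖g z‖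
  set d := 1 - ‖z‖ ^ 2
  have h3 : ((a * d)⁻¹ * d)⁻¹ = a := by field_simp
  rw [h3] at h2
  have h4 : a ≤ (a * d)⁻¹ * h2NormSq g := by linarith
  rw [inv_mul_eq_div, le_div_iff₀ (by positivity)] at h4
  linarith

lemma hk_herg_nonneg {w z : ℂ} (hz : z ∈ Metric.sphere (0:ℂ) 1) (hw : w ∈ unitDisk) :
    0 ≤ (herglotzRieszKernel 0 w z).re := by
  have hw' : ‖w‖ < 1 := by simpa [unitDisk] using hw
  have := le_re_herglotzRieszKernel (c := 0) hz hw
  rw [herglotzRieszKernel_def]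
  refine le_trans ?_ this
  rw [sub_zero]
  exact div_nonneg (by linarith) (by positivity)

lemma hk_herg_le {w z : ℂ} (hz : z ∈ Metric.sphere (0:ℂ) 1) (hw : w ∈ unitDisk) :
    (herglotzRieszKernel 0 w z).re ≤ (1 + ‖w‖) / (1 - ‖w‖) := by
  have := re_herglotzRieszKernel_le (c := 0) hz hw
  rw [herglotzRieszKernel_def]
  simpa using this

/-- Harmonic majorant of `‖g‖²` on the disk, for polynomial `g`. -/
lemma hk_majorant (g : Polynomial ℂ) : ∃ H : ℂ → ℂ, DifferentiableOn ℂ H unitDisk ∧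
    (∀ w ∈ unitDisk, ‖g.eval w‖ ^ 2 ≤ (H w).re) ∧
    ∀ w ∈ unitDisk, (H w).re ≤ (1 + ‖w‖) / (1 - ‖w‖) * Real.circleAverage (fun z => ‖g.eval z‖ ^ 2) 0 1 := by
  have hgc : Continuous fun z : ℂ => g.eval z := g.continuous
  have hvc : Continuous fun z : ℂ => ‖g.eval z‖ ^ 2 := hgc.norm.pow 2
  have hv : CircleIntegrable (fun z : ℂ => ‖g.eval z‖ ^ 2) 0 1 := hvc.continuousOn.circleIntegrable zero_le_one
  have hvC : CircleIntegrable (fun z : ℂ => ((‖g.eval z‖ ^ 2 : ℝ) : ℂ)) 0 1 :=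
    (continuous_ofReal.comp hvc).continuousOn.circleIntegrable zero_le_one
  have hker : ∀ w ∈ unitDisk, ContinuousOn (fun z => (herglotzRieszKernel 0 w z).re) (Metric.sphere 0 1) := by
    intro w hw
    have := continuousOn_herglotzRieszKernel_sphere (c := 0) (R := 1) hw
    rw [abs_one] at this
    exact continuous_re.comp_continuousOn this
  refine ⟨fun w => Real.circleAverage (fun ζ => herglotzRieszKernel 0 w ζ • ((‖g.eval ζ‖ ^ 2 : ℝ) : ℂ)) 0 1,
    fun w hw => ?_, fun w hw => ?_, fun w hw => ?_⟩
  · exact (hasDerivAt_circleAverage_herglotzRieszKernel_smul hvC hw).differentiableAt.differentiableWithinAt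
  · simp only
    rw [re_circleAverage_herglotzRieszKernel_smul hv hw]
    have h1 : DiffContOnCl ℂ (fun z => (g ^ 2).eval z) (Metric.ball 0 1) :=
      (g ^ 2).differentiable.diffContOnCl
    have h2 := h1.circleAverage_re_herglotzRieszKernel_smul hw
    have h3 : ‖g.eval w‖ ^ 2 = ‖(g ^ 2).eval w‖ := by simp
    rw [h3, ← h2]
    rw [Real.circleAverage_def, Real.circleAverage_def, norm_smul, smul_eq_mul, Real.norm_of_nonneg (by positivity)]
    refine mul_le_mul_of_nonneg_left ?_ (by positivity)
    refine (intervalIntegral.norm_integral_le_integral_norm (by positivity)).trans (le_of_eq ?_)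
    refine intervalIntegral.integral_congr fun θ _ => ?_
    simp only [Pi.smul_apply', Function.comp, norm_smul, smul_eq_mul, Polynomial.eval_pow, norm_pow]
    rw [Real.norm_of_nonneg (hk_herg_nonneg (circleMap_mem_sphere 0 zero_le_one θ) hw)]
  · simp only
    rw [re_circleAverage_herglotzRieszKernel_smul hv hw, ← smul_eq_mul, ← Real.circleAverage_fun_smul]
    refine Real.circleAverage_mono ?_ ?_ ?_
    · exact ((hker w hw).mul hvc.continuousOn).circleIntegrable zero_le_one
    · exact (continuousOn_const.mul hvc.continuousOn).circleIntegrable zero_le_one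
    · intro z hz
      rw [abs_one] at hz
      simp only [Pi.smul_apply', Function.comp, smul_eq_mul]
      exact mul_le_mul_of_nonneg_right (hk_herg_le hz hw) (by positivity)

lemma hk_poly_avg (g : Polynomial ℂ) :
    Real.circleAverage (fun z => ‖g.eval z‖ ^ 2) 0 1 = h2NormSq (fun z => g.eval z) := by
  have hp := (hk_fatou (hk_poly g)).2.2
  have hb : ∀ θ : ℝ, bdryVal (fun z => g.eval z) (exp (θ * I)) = g.eval (exp (θ * I)) := by
    intro θ
    refine Tendsto.limUnder_eq ?_
    have : Continuous (fun s : ℝ => g.eval (s * exp (θ * I))) := g.continuous.comp (by fun_prop)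
    have := this.tendsto 1
    simp only [ofReal_one, one_mul] at this
    exact this.mono_left nhdsWithin_le_nhds
  simp only [hb] at hp
  rw [Real.circleAverage_def, intervalIntegral.integral_of_le (by positivity)]
  simp only [circleMap, ofReal_one, one_mul, zero_add]
  rw [hp, smul_eq_mul]
  field_simp

lemma hk_littlewood {φ : ℂ → ℂ} (hφ : DifferentiableOn ℂ φ unitDisk) (hm : ∀ z ∈ unitDisk, φ z ∈ unitDisk)
    (g : Polynomial ℂ) : MemH2 (fun z => g.eval (φ z)) ∧
      h2NormSq (fun z => g.eval (φ z)) ≤ (1 + ‖φ 0‖) / (1 - ‖φ 0‖) * h2NormSq (fun z => g.eval z) := by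
  obtain ⟨H, hH, h1, h2⟩ := hk_majorant g
  rw [hk_poly_avg] at h2
  have h0 : (0:ℂ) ∈ unitDisk := by simp [unitDisk]
  refine hk_dom (r0 := 0) (g.differentiable.comp_differentiableOn hφ) zero_lt_one fun r hr _ hr1 => ?_
  have hHφ : DifferentiableOn ℂ (fun z => H (φ z)) unitDisk := hH.comp hφ hm
  have hsub : Metric.closedBall (0:ℂ) r ⊆ unitDisk := Metric.closedBall_subset_ball hr1
  have hmean : Real.circleAverage (fun z => H (φ z)) 0 r = H (φ 0) := by
    apply DiffContOnCl.circleAverage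
    rw [abs_of_nonneg hr]
    exact (hHφ.mono hsub).diffContOnCl_ball subset_rfl
  have hci : CircleIntegrable (fun z => H (φ z)) 0 r :=
    (hHφ.continuousOn.mono (Metric.sphere_subset_closedBall.trans hsub)).circleIntegrable hr
  have hre := Complex.reCLM.circleAverage_comp_comm hci
  rw [hmean] at hre
  have hle : Real.circleAverage (fun z => ‖g.eval (φ z)‖ ^ 2) 0 r ≤ (H (φ 0)).re := by
    refine le_trans (Real.circleAverage_mono ?_ ?_ ?_) hre.le
    · exact (((g.differentiable.comp_differentiableOn hφ).continuousOn.norm.pow 2).mono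
        (Metric.sphere_subset_closedBall.trans hsub)).circleIntegrable hr
    · exact ((continuous_re.comp_continuousOn hHφ.continuousOn).mono
        (Metric.sphere_subset_closedBall.trans hsub)).circleIntegrable hr
    · intro z hz
      rw [abs_of_nonneg hr] at hz
      exact h1 _ (hm _ (hsub (Metric.sphere_subset_closedBall hz)))
  have h3 := hle.trans (h2 _ (hm 0 h0))
  rw [Real.circleAverage_def, intervalIntegral.integral_of_le (by positivity), smul_eq_mul,
    inv_mul_le_iff₀ (by positivity)] at h3
  simpa [cavg, circleMap] using h3

lemma hk_self_mem {φ : ℂ → ℂ} (hφ : DifferentiableOn ℂ φ unitDisk) (hm : ∀ z ∈ unitDisk, φ z ∈ unitDisk) :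
    MemH2 φ := by
  have := (hk_littlewood hφ hm Polynomial.X).1
  simpa using this

lemma hk_mul_poly {φ u : ℂ → ℂ} (hφ : DifferentiableOn ℂ φ unitDisk) (hm : ∀ z ∈ unitDisk, φ z ∈ unitDisk)
    (hu : MemH2 u) (g : Polynomial ℂ) : MemH2 (fun z => u z * g.eval (φ z)) := by
  obtain ⟨M, hM⟩ := (isCompact_closedBall (0:ℂ) 1).exists_bound_of_continuousOn
    (g.continuous.continuousOn)
  refine (hk_mul_bdd (C := M) (hu.1.mul (g.differentiable.comp_differentiableOn hφ)) hu (r0 := 0)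
    zero_lt_one fun z hz _ => ?_).1
  have h1 := hM (φ z) (Metric.ball_subset_closedBall (hm z hz))
  rw [Pi.mul_apply, norm_mul, mul_comm]
  exact mul_le_mul_of_nonneg_right h1 (norm_nonneg _)

lemma hk_est_poly {φ u : ℂ → ℂ} (hφ : DifferentiableOn ℂ φ unitDisk) (hm : ∀ z ∈ unitDisk, φ z ∈ unitDisk)
    (hu : MemH2 u) {ε ρ : ℝ}
    (hess : ∀ᵐ (θ : ℝ) ∂(volume.restrict (Set.Ioc (0:ℝ) (2 * Real.pi))),
        ρ < ‖bdryVal φ (Complex.exp (θ * Complex.I))‖ →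
          ‖bdryVal u (Complex.exp (θ * Complex.I))‖ ≤ ε)
    (g : Polynomial ℂ) {M : ℝ} (hM : ∀ w : ℂ, ‖w‖ ≤ ρ → ‖g.eval w‖ ≤ M) :
    h2NormSq (fun z => u z * g.eval (φ z)) ≤
      ε ^ 2 * ((1 + ‖φ 0‖) / (1 - ‖φ 0‖) * h2NormSq (fun z => g.eval z)) + M ^ 2 * h2NormSq u := by
  obtain ⟨hL1, hL2⟩ := hk_littlewood hφ hm g
  obtain ⟨a1, -, -⟩ := hk_fatou (hk_self_mem hφ hm)
  obtain ⟨b1, b2, b3⟩ := hk_fatou hu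
  obtain ⟨-, c2, c3⟩ := hk_fatou hL1
  obtain ⟨-, d2, d3⟩ := hk_fatou (hk_mul_poly hφ hm hu g)
  have key : ∫ θ in Ioc (0:ℝ) (2 * Real.pi), ‖bdryVal (fun z => u z * g.eval (φ z)) (exp (θ * I))‖ ^ 2 ≤
      ∫ θ in Ioc (0:ℝ) (2 * Real.pi), (ε ^ 2 * ‖bdryVal (fun z => g.eval (φ z)) (exp (θ * I))‖ ^ 2 +
        M ^ 2 * ‖bdryVal u (exp (θ * I))‖ ^ 2) := by
    refine integral_mono_ae d2 ((c2.const_mul _).add (b2.const_mul _)) ?_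
    filter_upwards [a1, b1, hess] with θ h1 h2 h3
    have h4 := (g.continuous.tendsto _).comp h1
    have e1 : bdryVal (fun z => g.eval (φ z)) (exp (θ * I)) = g.eval (bdryVal φ (exp (θ * I))) :=
      h4.limUnder_eq
    have e2 : bdryVal (fun z => u z * g.eval (φ z)) (exp (θ * I)) =
        bdryVal u (exp (θ * I)) * g.eval (bdryVal φ (exp (θ * I))) :=
      (h2.mul h4).limUnder_eq
    rw [e1, e2, norm_mul, mul_pow]
    rcases lt_or_ge ρ ‖bdryVal φ (exp (θ * I))‖ with h | h
    · have h5 := h3 h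
      have : ‖bdryVal u (exp (θ * I))‖ ^ 2 * ‖g.eval (bdryVal φ (exp (θ * I)))‖ ^ 2 ≤
        ε ^ 2 * ‖g.eval (bdryVal φ (exp (θ * I)))‖ ^ 2 := by gcongr
      have h6 : 0 ≤ M ^ 2 * ‖bdryVal u (exp (θ * I))‖ ^ 2 := by positivity
      linarith
    · have h5 := hM _ h
      have : ‖bdryVal u (exp (θ * I))‖ ^ 2 * ‖g.eval (bdryVal φ (exp (θ * I)))‖ ^ 2 ≤
        ‖bdryVal u (exp (θ * I))‖ ^ 2 * M ^ 2 := by gcongr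
      have h6 : 0 ≤ ε ^ 2 * ‖g.eval (bdryVal φ (exp (θ * I)))‖ ^ 2 := by positivity
      linarith
  rw [integral_add (c2.const_mul _) (b2.const_mul _), integral_const_mul, integral_const_mul, d3, c3, b3] at key
  have hpi : 0 < 2 * Real.pi := by positivity
  have h7 : h2NormSq (fun z => u z * g.eval (φ z)) ≤
      ε ^ 2 * h2NormSq (fun z => g.eval (φ z)) + M ^ 2 * h2NormSq u := by
    refine le_of_mul_le_mul_left ?_ hpi
    linarith
  refine h7.trans ?_
  gcongr

/-- Truncation of a power series. -/
def truncP (c : ℕ → ℂ) (n : ℕ) : Polynomial ℂ :=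
  ∑ k ∈ Finset.range n, Polynomial.C (c k) * Polynomial.X ^ k

lemma truncP_eval (c : ℕ → ℂ) (n : ℕ) (z : ℂ) :
    (truncP c n).eval z = ∑ k ∈ Finset.range n, c k * z ^ k := by
  simp [truncP, Polynomial.eval_finsetSum]

lemma truncP_coeff (c : ℕ → ℂ) (n k : ℕ) : (truncP c n).coeff k = if k < n then c k else 0 := by
  simp [truncP, Polynomial.coeff_X_pow]

lemma truncP_norm {g : ℂ → ℂ} (hg : MemH2 g) (n : ℕ) :
    h2NormSq (fun z => (truncP (taylorCoeff g) n).eval z) ≤ h2NormSq g := by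
  refine (hk_poly _).2.tsum_le_tsum (fun k => ?_) hg.2
  rw [hk_poly_coeff, truncP_coeff]
  split_ifs
  · exact le_rfl
  · simp

lemma hk_abs_summable {g : ℂ → ℂ} (hg : DifferentiableOn ℂ g unitDisk) {ρ : ℝ} (h0 : 0 ≤ ρ) (h1 : ρ < 1) :
    Summable (fun k => ‖taylorCoeff g k‖ * ρ ^ k) := by
  have hr : (ρ : ℂ) ∈ unitDisk := by simp [unitDisk, abs_of_nonneg h0, h1]
  have := (hk_hasSum hg hr).summable.norm
  simpa [norm_mul, norm_pow, abs_of_nonneg h0] using this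

open Topology in
lemma hk_est {φ u : ℂ → ℂ} (hφ : DifferentiableOn ℂ φ unitDisk) (hm : ∀ z ∈ unitDisk, φ z ∈ unitDisk)
    (hu : MemH2 u) {ε ρ : ℝ} (hρ0 : 0 ≤ ρ) (hρ1 : ρ < 1)
    (hess : ∀ᵐ (θ : ℝ) ∂(volume.restrict (Set.Ioc (0:ℝ) (2 * Real.pi))),
        ρ < ‖bdryVal φ (Complex.exp (θ * Complex.I))‖ →
          ‖bdryVal u (Complex.exp (θ * Complex.I))‖ ≤ ε)
    {g : ℂ → ℂ} (hg : MemH2 g) :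
    MemH2 (fun z => u z * g (φ z)) ∧ h2NormSq (fun z => u z * g (φ z)) ≤
      ε ^ 2 * ((1 + ‖φ 0‖) / (1 - ‖φ 0‖) * h2NormSq g) +
        (∑' k, ‖taylorCoeff g k‖ * ρ ^ k) ^ 2 * h2NormSq u := by
  have h00 : ‖φ 0‖ < 1 := by
    have := hm 0 (by simp [unitDisk])
    simpa [unitDisk] using this
  set B := ε ^ 2 * ((1 + ‖φ 0‖) / (1 - ‖φ 0‖) * h2NormSq g) +
        (∑' k, ‖taylorCoeff g k‖ * ρ ^ k) ^ 2 * h2NormSq u with hB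
  have hsum := hk_abs_summable hg.1 hρ0 hρ1
  have hn : ∀ n, h2NormSq (fun z => u z * (truncP (taylorCoeff g) n).eval (φ z)) ≤ B := by
    intro n
    refine (hk_est_poly hφ hm hu hess (truncP (taylorCoeff g) n)
      (M := ∑' k, ‖taylorCoeff g k‖ * ρ ^ k) fun w hw => ?_).trans ?_
    · rw [truncP_eval]
      refine (norm_sum_le _ _).trans ?_
      refine le_trans (Finset.sum_le_sum fun k _ => ?_)
        (hsum.sum_le_tsum (Finset.range n) (fun k _ => by positivity))
      rw [norm_mul, norm_pow]
      gcongr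
    · have := truncP_norm hg n
      have h1 : 0 < 1 - ‖φ 0‖ := by linarith
      rw [hB]
      gcongr
  have hd : DifferentiableOn ℂ (fun z => u z * g (φ z)) unitDisk := hu.1.mul (hg.1.comp hφ hm)
  refine hk_dom hd (r0 := 0) zero_lt_one fun r hr _ hr1 => ?_
  have hlim : Tendsto (fun n => cavg (fun z => u z * (truncP (taylorCoeff g) n).eval (φ z)) r) atTop
      (𝓝 (cavg (fun z => u z * g (φ z)) r)) := by
    refine tendsto_integral_of_dominated_convergence
      (fun θ : ℝ => ‖u (r * exp (θ * I))‖ ^ 2 * (h2NormSq g / (1 - ‖φ (r * exp (θ * I))‖ ^ 2))) ?_ ?_ ?_ ?_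
    · intro n
      exact (hk_circle_int (hk_mul_poly hφ hm hu _).1.continuousOn hr hr1).aestronglyMeasurable
    · have : Continuous (fun θ : ℝ => ‖u (r * exp (θ * I))‖ ^ 2 *
          (h2NormSq g / (1 - ‖φ (r * exp (θ * I))‖ ^ 2))) := by
        refine ((hk_circle_cont hu.1.continuousOn hr hr1).norm.pow 2).mul
          (continuous_const.div (continuous_const.sub ((hk_circle_cont hφ.continuousOn hr hr1).norm.pow 2)) ?_)
        intro θ
        have : ‖φ (r * exp (θ * I))‖ < 1 := by simpa [unitDisk] using hm _ (hk_mem_circle hr hr1 θ)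
        have h0 := norm_nonneg (φ (r * exp (θ * I)))
        have : ‖φ (r * exp (θ * I))‖ ^ 2 < 1 := by nlinarith
        linarith
      exact this.integrableOn_Icc.mono_set Ioc_subset_Icc_self
    · intro n
      refine Eventually.of_forall fun θ => ?_
      have hz := hm _ (hk_mem_circle hr hr1 θ)
      have h1 := hk_growth (hk_poly (truncP (taylorCoeff g) n)) hz
      have h2 : ‖φ (r * exp (θ * I))‖ < 1 := by simpa [unitDisk] using hz
      have h3 : 0 < 1 - ‖φ (r * exp (θ * I))‖ ^ 2 := by nlinarith [norm_nonneg (φ (r * exp (θ * I)))]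
      have h4 := truncP_norm hg n
      rw [Real.norm_of_nonneg (by positivity), norm_mul, mul_pow]
      refine mul_le_mul_of_nonneg_left (h1.trans ?_) (by positivity)
      gcongr
    · refine Eventually.of_forall fun θ => ?_
      have hz := hm _ (hk_mem_circle hr hr1 θ)
      have h1 := (hk_hasSum hg.1 hz).tendsto_sum_nat
      simp only [← truncP_eval] at h1
      exact ((h1.const_mul _).norm.pow 2)
  refine le_of_tendsto hlim (Eventually.of_forall fun n => ?_)
  refine (hk_cavg_le (hk_mul_poly hφ hm hu _) hr hr1).trans ?_
  have := hn n
  gcongr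

lemma hk_norm_lt {z : ℂ} (hz : z ∈ unitDisk) : ‖z‖ < 1 := by simpa [unitDisk] using hz

lemma hk_poly_mul (A : Polynomial ℂ) : ∃ C : ℝ, 0 ≤ C ∧ ∀ g, MemH2 g →
    MemH2 (fun z => A.eval z * g z) ∧ h2NormSq (fun z => A.eval z * g z) ≤ C * h2NormSq g := by
  obtain ⟨M, hM⟩ := (isCompact_closedBall (0:ℂ) 1).exists_bound_of_continuousOn
    (A.continuous.continuousOn)
  refine ⟨M ^ 2, by positivity, fun g hg => ?_⟩
  refine hk_mul_bdd (r0 := 0) (A.differentiable.differentiableOn.mul hg.1) hg zero_lt_one fun z hz _ => ?_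
  rw [Pi.mul_apply, norm_mul]
  exact mul_le_mul_of_nonneg_right (hM z (Metric.ball_subset_closedBall hz)) (norm_nonneg _)

/-- Polynomials without zeros in the disk for which division inside `H²` is polynomial division. -/
def GoodP (A : Polynomial ℂ) : Prop :=
  (∀ z ∈ unitDisk, A.eval z ≠ 0) ∧ ∀ (q : Polynomial ℂ) (g : ℂ → ℂ), MemH2 g →
    (∀ z ∈ unitDisk, q.eval z = A.eval z * g z) → A ∣ q

lemma goodP_one : GoodP 1 := ⟨by simp, fun q g _ _ => one_dvd q⟩

lemma hk_poly_ext {p q : Polynomial ℂ} (h : ∀ z ∈ unitDisk, p.eval z = q.eval z) : p = q := by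
  refine Polynomial.eq_of_infinite_eval_eq p q (Set.Infinite.mono (s := unitDisk) h ?_)
  exact infinite_of_mem_nhds 0 (Metric.ball_mem_nhds 0 one_pos)

lemma goodP_mul {A B : Polynomial ℂ} (hA : GoodP A) (hB : GoodP B) : GoodP (A * B) := by
  refine ⟨fun z hz => by simpa using ⟨hA.1 z hz, hB.1 z hz⟩, fun q g hg h => ?_⟩
  obtain ⟨C, -, hC⟩ := hk_poly_mul B
  obtain ⟨q', rfl⟩ := hA.2 q (fun z => B.eval z * g z) (hC g hg).1 fun z hz => by
    rw [h z hz, Polynomial.eval_mul, mul_assoc]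
  refine mul_dvd_mul_left A (hB.2 q' g hg fun z hz => ?_)
  have := h z hz
  rw [Polynomial.eval_mul, Polynomial.eval_mul, mul_assoc] at this
  exact mul_left_cancel₀ (hA.1 z hz) this

lemma goodP_pow {A : Polynomial ℂ} (hA : GoodP A) (k : ℕ) : GoodP (A ^ k) := by
  induction k with
  | zero => simpa using goodP_one
  | succ k ih => rw [pow_succ]; exact goodP_mul ih hA

open Topology in
lemma goodP_X {a : ℂ} (ha : a ∈ unitCircle) : GoodP (Polynomial.X - Polynomial.C a) := by
  have ha' : ‖a‖ = 1 := by simpa [unitCircle] using ha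
  refine ⟨fun z hz h0 => ?_, fun q g hg h => ?_⟩
  · have : z = a := by simpa [sub_eq_zero] using h0
    have := hk_norm_lt hz
    simp_all
  · rw [Polynomial.dvd_iff_isRoot, Polynomial.IsRoot.def]
    have h1 : Tendsto (fun r : ℝ => ‖q.eval (r * a)‖ ^ 2) (𝓝[<] 1) (𝓝 (‖q.eval a‖ ^ 2)) := by
      have : Continuous (fun r : ℝ => ‖q.eval (r * a)‖ ^ 2) :=
        (q.continuous.comp (by fun_prop)).norm.pow 2
      have := this.tendsto 1
      simp only [ofReal_one, one_mul] at this
      exact this.mono_left nhdsWithin_le_nhds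
    have h2 : Tendsto (fun r : ℝ => (1 - r) * h2NormSq g) (𝓝[<] 1) (𝓝 0) := by
      have : Continuous (fun r : ℝ => (1 - r) * h2NormSq g) := by fun_prop
      have := this.tendsto 1
      simp only [sub_self, zero_mul] at this
      exact this.mono_left nhdsWithin_le_nhds
    have h3 : ‖q.eval a‖ ^ 2 ≤ 0 := by
      refine le_of_tendsto_of_tendsto h1 h2 ?_
      filter_upwards [Ioo_mem_nhdsLT (show (0:ℝ) < 1 by norm_num)] with r hr
      have hn : ‖(r : ℂ) * a‖ = r := by simp [ha', abs_of_pos hr.1]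
      have hz : (r : ℂ) * a ∈ unitDisk := by
        simp only [unitDisk, Metric.mem_ball, dist_zero_right, hn]; exact hr.2
      have hgr := hk_growth hg hz
      rw [h _ hz, norm_mul, mul_pow]
      rw [hn] at hgr
      have h4 : ‖(Polynomial.X - Polynomial.C a).eval ((r : ℂ) * a)‖ = 1 - r := by
        have : (Polynomial.X - Polynomial.C a).eval ((r : ℂ) * a) = ((r - 1 : ℝ) : ℂ) * a := by
          simp; ring
        rw [this, norm_mul, ha', mul_one, norm_real, Real.norm_eq_abs, abs_sub_comm, abs_of_pos]
        linarith [hr.2]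
      rw [h4]
      have h5 : 0 < 1 - r := by linarith [hr.2]
      have h7 : 0 < 1 - r ^ 2 := by nlinarith [hr.1, hr.2]
      calc (1 - r) ^ 2 * ‖g (r * a)‖ ^ 2 ≤ (1 - r) ^ 2 * (h2NormSq g / (1 - r ^ 2)) := by gcongr
        _ ≤ (1 - r) * h2NormSq g := by
          rw [mul_div_assoc', div_le_iff₀ h7]
          have := hk_nonneg g
          have h8 : 0 ≤ (1 - r) * h2NormSq g := by positivity
          nlinarith [mul_nonneg h8 h5.le, mul_nonneg h8 hr.1.le, mul_nonneg (mul_nonneg h8 h5.le) hr.1.le]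
    have h9 : ‖q.eval a‖ = 0 := by
      have := norm_nonneg (q.eval a)
      nlinarith
    exact norm_eq_zero.1 h9

/-- `a₁` as a polynomial. -/
def aPoly {n : ℕ} (ξ : Fin n → ℂ) (m : Fin n → ℕ) : Polynomial ℂ :=
  ∏ j, (Polynomial.X - Polynomial.C (ξ j)) ^ (m j)

lemma aPoly_eval {n : ℕ} (ξ : Fin n → ℂ) (m : Fin n → ℕ) (z : ℂ) :
    (aPoly ξ m).eval z = a1fun ξ m z := by
  simp [aPoly, a1fun, Polynomial.eval_prod]

lemma aPoly_monic {n : ℕ} (ξ : Fin n → ℂ) (m : Fin n → ℕ) : (aPoly ξ m).Monic :=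
  Polynomial.monic_prod_of_monic _ _ fun j _ => (Polynomial.monic_X_sub_C _).pow _

lemma aPoly_natDegree {n : ℕ} (ξ : Fin n → ℂ) (m : Fin n → ℕ) :
    (aPoly ξ m).natDegree = ∑ j, m j := by
  rw [aPoly, Polynomial.natDegree_prod_of_monic _ _ fun j _ => (Polynomial.monic_X_sub_C _).pow _]
  refine Finset.sum_congr rfl fun j _ => ?_
  rw [(Polynomial.monic_X_sub_C (ξ j)).natDegree_pow]; simp

lemma aPoly_degree {n : ℕ} (ξ : Fin n → ℂ) (m : Fin n → ℕ) :
    (aPoly ξ m).degree = ((∑ j, m j : ℕ) : WithBot ℕ) := by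
  rw [Polynomial.degree_eq_natDegree (aPoly_monic ξ m).ne_zero, aPoly_natDegree]

lemma aPoly_good {n : ℕ} {ξ : Fin n → ℂ} (m : Fin n → ℕ) (hξ : ∀ j, ξ j ∈ unitCircle) :
    GoodP (aPoly ξ m) :=
  Finset.prod_induction _ GoodP (fun _ _ => goodP_mul) goodP_one fun j _ => goodP_pow (goodP_X (hξ j)) _

lemma hb_norm_eq {n : ℕ} {ξ : Fin n → ℂ} {m : Fin n → ℕ} (hξ : ∀ j, ξ j ∈ unitCircle)
    {f g : ℂ → ℂ} {q : Polynomial ℂ} (h : HbDecompOf ξ m f g q) :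
    hbNormSq ξ m f = h2NormSq g + h2NormSq fun z => q.eval z := by
  have hm : MemHb ξ m f := ⟨(g, q), h⟩
  have hs : HbDecompOf ξ m f (hbDecomp ξ m f).1 (hbDecomp ξ m f).2 := by
    rw [hbDecomp, dif_pos hm]; exact hm.choose_spec
  have hA := aPoly_good m hξ
  set g' := (hbDecomp ξ m f).1
  set q' := (hbDecomp ξ m f).2
  have hdiv : aPoly ξ m ∣ q' - q := by
    refine hA.2 _ _ (hk_sub h.1 hs.1).1 fun z hz => ?_
    have h1 := h.2.2 z hz
    have h2 := hs.2.2 z hz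
    rw [Polynomial.eval_sub, aPoly_eval]
    linear_combination h1 - h2
  have hq : q' - q = 0 := by
    refine Polynomial.eq_zero_of_dvd_of_degree_lt hdiv ?_
    rw [aPoly_degree]
    exact (Polynomial.degree_sub_le _ _).trans_lt (max_lt hs.2.1 h.2.1)
  have hq' : q' = q := sub_eq_zero.1 hq
  have hg : ∀ z ∈ unitDisk, g' z = g z := by
    intro z hz
    have h1 := h.2.2 z hz
    have h2 := hs.2.2 z hz
    rw [hq'] at h2
    refine mul_left_cancel₀ (hA.1 z hz) ?_
    rw [aPoly_eval]
    linear_combination h1 - h2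
  show h2NormSq g' + h2NormSq (fun z => q'.eval z) = _
  rw [hq', hk_norm_congr h.1.1 hg]

/-- Division with remainder by `h` in `H²`, with bounds. -/
def DivP (h : Polynomial ℂ) : Prop :=
  ∃ (C : ℝ) (D : ℕ), 0 ≤ C ∧ ∀ g, MemH2 g → ∃ (g1 : ℂ → ℂ) (r : Polynomial ℂ), MemH2 g1 ∧
    r.natDegree ≤ D ∧ (∀ z ∈ unitDisk, g z = h.eval z * g1 z + r.eval z) ∧
    h2NormSq g1 ≤ C * h2NormSq g ∧ h2NormSq (fun z => r.eval z) ≤ C * h2NormSq g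

lemma divP_one : DivP 1 := by
  refine ⟨1, 0, zero_le_one, fun g hg => ⟨g, 0, hg, by simp, by simp, by simp, ?_⟩⟩
  have : h2NormSq (fun z => (0 : Polynomial ℂ).eval z) = 0 := by rw [hk_poly_norm]; simp
  rw [this, one_mul]; exact hk_nonneg g

lemma divP_mul {A B : Polynomial ℂ} (hA : DivP A) (hB : DivP B) : DivP (A * B) := by
  obtain ⟨C1, D1, hC1, h1⟩ := hA
  obtain ⟨C2, D2, hC2, h2⟩ := hB
  obtain ⟨M, hM, hM2⟩ := hk_poly_mul A
  refine ⟨C2 * C1 + (2 * (M * (C2 * C1)) + 2 * C1), max (A.natDegree + D2) D1, by positivity, fun g hg => ?_⟩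
  obtain ⟨g1, r1, a1, a2, a3, a4, a5⟩ := h1 g hg
  obtain ⟨g2, r2, b1, b2, b3, b4, b5⟩ := h2 g1 a1
  have hg0 := hk_nonneg g
  have e1 : C2 * h2NormSq g1 ≤ C2 * C1 * h2NormSq g := by rw [mul_assoc]; gcongr
  refine ⟨g2, A * r2 + r1, b1, ?_, fun z hz => ?_, ?_, ?_⟩
  · refine (Polynomial.natDegree_add_le _ _).trans (max_le_max ?_ a2)
    exact Polynomial.natDegree_mul_le.trans (by gcongr)
  · rw [a3 z hz, b3 z hz]; simp; ring
  · have : 0 ≤ (2 * (M * (C2 * C1)) + 2 * C1) * h2NormSq g := by positivity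
    linarith
  · have h3 := (hk_add (hM2 _ (hk_poly r2)).1 (hk_poly r1)).2
    have h4 := (hM2 _ (hk_poly r2)).2
    have h5 : M * h2NormSq (fun z => r2.eval z) ≤ M * (C2 * C1 * h2NormSq g) := by
      have := b5.trans e1
      gcongr
    simp only [Polynomial.eval_add, Polynomial.eval_mul]
    have : 0 ≤ C2 * C1 * h2NormSq g := by positivity
    linarith

lemma divP_pow {A : Polynomial ℂ} (hA : DivP A) (k : ℕ) : DivP (A ^ k) := by
  induction k with
  | zero => simpa using divP_one
  | succ k ih => rw [pow_succ]; exact divP_mul ih hA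

lemma hk_const_norm (a : ℂ) : h2NormSq (fun _ => a) = ‖a‖ ^ 2 := by
  have := hk_poly_norm (Polynomial.C a)
  simpa using this

lemma divP_X {a : ℂ} (ha : a ∈ unitDisk) : DivP (Polynomial.X - Polynomial.C a) := by
  have ha' := hk_norm_lt ha
  have hd : 0 < 1 - ‖a‖ ^ 2 := by nlinarith [norm_nonneg a]
  have hd2 : 0 < 1 - ‖a‖ := by linarith
  set E : ℝ := (1 - ‖a‖ ^ 2)⁻¹ with hE
  have hE0 : 0 ≤ E := by positivity
  refine ⟨(2 / (1 - ‖a‖)) ^ 2 * (2 + 2 * E) + E, 0, by positivity, fun g hg => ?_⟩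
  have hg0 := hk_nonneg g
  have hga : ‖g a‖ ^ 2 ≤ E * h2NormSq g := by
    have := hk_growth hg ha
    rwa [div_eq_inv_mul] at this
  have hF := hk_sub hg (hk_poly (Polynomial.C (g a)))
  simp only [Polynomial.eval_C, hk_const_norm] at hF
  have hds : DifferentiableOn ℂ (dslope g a) unitDisk :=
    (Complex.differentiableOn_dslope (Metric.isOpen_ball.mem_nhds ha)).2 hg.1
  have hb := hk_mul_bdd (C := 2 / (1 - ‖a‖)) (r0 := (1 + ‖a‖) / 2) hds hF.1 (by linarith) fun z hz hr => by
    have hza : (1 - ‖a‖) / 2 ≤ ‖z - a‖ := by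
      have := norm_sub_norm_le z a
      linarith
    have hne : z ≠ a := by
      rintro rfl
      simp at hza; linarith
    rw [dslope_of_ne _ hne, slope_def_field, norm_div, div_le_iff₀ (by linarith)]
    have h0 := norm_nonneg (g z - g a)
    calc ‖g z - g a‖ = 2 / (1 - ‖a‖) * ‖g z - g a‖ * ((1 - ‖a‖) / 2) := by field_simp
      _ ≤ _ := by gcongr
  refine ⟨dslope g a, Polynomial.C (g a), hb.1, by simp, fun z hz => ?_, ?_, ?_⟩
  · have := sub_smul_dslope g a z
    simp only [smul_eq_mul] at this
    simp [this]
  · refine hb.2.trans ?_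
    have h3 : h2NormSq (fun z => g z - g a) ≤ (2 + 2 * E) * h2NormSq g := by linarith [hF.2]
    have h4 : 0 ≤ E * h2NormSq g := by positivity
    calc _ ≤ (2 / (1 - ‖a‖)) ^ 2 * ((2 + 2 * E) * h2NormSq g) := by gcongr
      _ ≤ _ := by linarith
  · simp only [Polynomial.eval_C, hk_const_norm]
    have : 0 ≤ (2 / (1 - ‖a‖)) ^ 2 * (2 + 2 * E) * h2NormSq g := by positivity
    linarith

lemma hk_pow_decomp {n : ℕ} {ξ : Fin n → ℂ} {m : Fin n → ℕ} {φ : ℂ → ℂ}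
    (hφb : MemHb ξ m φ) (hφ : DifferentiableOn ℂ φ unitDisk) (hm : ∀ z ∈ unitDisk, φ z ∈ unitDisk) (k : ℕ) :
    ∃ (G : ℂ → ℂ) (R : Polynomial ℂ), HbDecompOf ξ m (fun z => φ z ^ k) G R := by
  have red : ∀ (F G : ℂ → ℂ) (Q : Polynomial ℂ), MemH2 G →
      (∀ z ∈ unitDisk, F z = a1fun ξ m z * G z + Q.eval z) →
      ∃ (G : ℂ → ℂ) (R : Polynomial ℂ), HbDecompOf ξ m F G R := by
    intro F G Q hG h
    refine ⟨fun z => G z + (Q /ₘ aPoly ξ m).eval z, Q %ₘ aPoly ξ m, (hk_add hG (hk_poly _)).1, ?_, ?_⟩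
    · rw [← aPoly_degree ξ m]
      exact Polynomial.degree_modByMonic_lt _ (aPoly_monic ξ m)
    · intro z hz
      rw [h z hz]
      conv_lhs => rw [← Polynomial.modByMonic_add_div Q (aPoly ξ m)]
      rw [Polynomial.eval_add, Polynomial.eval_mul, aPoly_eval]
      ring
  obtain ⟨⟨g0, q0⟩, h0⟩ := hφb
  induction k with
  | zero =>
    have hz : MemH2 (fun _ => (0:ℂ)) := by simpa using hk_poly 0
    exact red _ (fun _ => 0) 1 hz (by simp)
  | succ k ih =>
    obtain ⟨G, R, h1⟩ := ih
    have hφG : MemH2 (fun z => G z * φ z) := by simpa using hk_mul_poly hφ hm h1.1 Polynomial.X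
    obtain ⟨C, -, hC⟩ := hk_poly_mul R
    refine red _ (fun z => G z * φ z + R.eval z * g0 z) (q0 * R) (hk_add hφG (hC g0 h0.1).1).1 fun z hz => ?_
    have e1 := h1.2.2 z hz
    have e2 := h0.2.2 z hz
    simp only at e1 e2
    rw [pow_succ, e1, Polynomial.eval_mul]
    linear_combination (R.eval z) * e2

lemma hk_finsum (G : ℕ → ℂ → ℂ) (hG : ∀ k, MemH2 (G k)) (n : ℕ) : ∃ K : ℝ, 0 ≤ K ∧ ∀ s : ℕ → ℂ,
    MemH2 (fun z => ∑ k ∈ Finset.range n, s k * G k z) ∧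
    h2NormSq (fun z => ∑ k ∈ Finset.range n, s k * G k z) ≤ K * ∑ k ∈ Finset.range n, ‖s k‖ ^ 2 := by
  induction n with
  | zero =>
    refine ⟨0, le_rfl, fun s => ?_⟩
    simp only [Finset.range_zero, Finset.sum_empty, hk_const_norm]
    exact ⟨by simpa using hk_poly 0, by simp⟩
  | succ n ih =>
    obtain ⟨K, hK, h⟩ := ih
    have h0 := hk_nonneg (G n)
    refine ⟨2 * K + 2 * h2NormSq (G n), by positivity, fun s => ?_⟩
    obtain ⟨h1, h2⟩ := h s
    obtain ⟨h3, h4⟩ := hk_smul (hG n) (s n)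
    obtain ⟨h5, h6⟩ := hk_add h1 h3
    simp only [Finset.sum_range_succ]
    refine ⟨h5, h6.trans ?_⟩
    rw [h4]
    have a1 : 0 ≤ ∑ k ∈ Finset.range n, ‖s k‖ ^ 2 := by positivity
    have a2 : 0 ≤ 2 * K * ‖s n‖ ^ 2 := by positivity
    have a3 : 0 ≤ 2 * h2NormSq (G n) * ∑ k ∈ Finset.range n, ‖s k‖ ^ 2 := by positivity
    linarith

lemma hk_poly_norm_le (s : Polynomial ℂ) (n : ℕ) :
    ∑ k ∈ Finset.range n, ‖s.coeff k‖ ^ 2 ≤ h2NormSq (fun z => s.eval z) := by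
  have := (hk_poly s).2.sum_le_tsum (Finset.range n) (fun _ _ => by positivity)
  simpa only [hk_poly_coeff, h2NormSq] using this

lemma hk_poly_norm_eq {s : Polynomial ℂ} {D : ℕ} (hs : s.natDegree ≤ D) :
    h2NormSq (fun z => s.eval z) = ∑ k ∈ Finset.range (D + 1), ‖s.coeff k‖ ^ 2 := by
  simp only [h2NormSq, hk_poly_coeff]
  refine tsum_eq_sum fun k hk => ?_
  rw [Polynomial.coeff_eq_zero_of_natDegree_lt (by simp at hk; omega)]; simp

lemma hk_eval_eq {s : Polynomial ℂ} {D : ℕ} (hs : s.natDegree ≤ D) (w : ℂ) :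
    s.eval w = ∑ k ∈ Finset.range (D + 1), s.coeff k * w ^ k :=
  Polynomial.eval_eq_sum_range' (by omega) w

/-- Composition estimate from a decomposition. -/
lemma hk_lemB {n : ℕ} {ξ : Fin n → ℂ} {m : Fin n → ℕ} {φ u : ℂ → ℂ} {h : Polynomial ℂ}
    (hξ : ∀ j, ξ j ∈ unitCircle)
    (hφb : MemHb ξ m φ) (hφ : DifferentiableOn ℂ φ unitDisk) (hm : ∀ z ∈ unitDisk, φ z ∈ unitDisk)
    (hu : ∀ z ∈ unitDisk, a1fun ξ m (φ z) * h.eval (φ z) = a1fun ξ m z * u z) (D : ℕ) :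
    ∃ K : ℝ, 0 ≤ K ∧ ∀ (g1 : ℂ → ℂ) (s : Polynomial ℂ) (F : ℂ → ℂ), s.natDegree ≤ D →
      MemH2 (fun z => u z * g1 (φ z)) →
      (∀ z ∈ unitDisk, F z = a1fun ξ m (φ z) * h.eval (φ z) * g1 (φ z) + s.eval (φ z)) →
      MemHb ξ m F ∧ hbNormSq ξ m F ≤
        2 * h2NormSq (fun z => u z * g1 (φ z)) + K * h2NormSq (fun z => s.eval z) := by
  choose G R hGR using hk_pow_decomp hφb hφ hm
  obtain ⟨K1, hK1, h1⟩ := hk_finsum G (fun k => (hGR k).1) (D + 1)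
  obtain ⟨K2, hK2, h2⟩ := hk_finsum (fun k z => (R k).eval z) (fun k => hk_poly _) (D + 1)
  refine ⟨2 * K1 + K2, by positivity, fun g1 s F hs hmem hF => ?_⟩
  obtain ⟨a1, a2⟩ := h1 s.coeff
  obtain ⟨b1, b2⟩ := h2 s.coeff
  obtain ⟨c1, c2⟩ := hk_add hmem a1
  set Q : Polynomial ℂ := ∑ k ∈ Finset.range (D + 1), Polynomial.C (s.coeff k) * R k with hQ
  have hQe : ∀ z, Q.eval z = ∑ k ∈ Finset.range (D + 1), s.coeff k * (R k).eval z := by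
    intro z; simp [hQ, Polynomial.eval_finsetSum]
  have hdec : HbDecompOf ξ m F (fun z => u z * g1 (φ z) + ∑ k ∈ Finset.range (D + 1), s.coeff k * G k z) Q := by
    refine ⟨c1, ?_, fun z hz => ?_⟩
    · rw [← Polynomial.mem_degreeLT]
      refine Submodule.sum_mem _ fun k _ => ?_
      rw [← Polynomial.smul_eq_C_mul]
      exact Submodule.smul_mem _ _ (Polynomial.mem_degreeLT.2 (hGR k).2.1)
    · rw [hF z hz, hu z hz, hk_eval_eq hs, hQe, mul_add, Finset.mul_sum, add_assoc, ← Finset.sum_add_distrib]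
      congr 1
      · ring
      · refine Finset.sum_congr rfl fun k _ => ?_
        have := (hGR k).2.2 z hz
        simp only at this
        rw [this]; ring
  refine ⟨⟨(_, Q), hdec⟩, ?_⟩
  rw [hb_norm_eq hξ hdec]
  simp only [hQe]
  rw [hk_poly_norm_eq hs]
  linarith

lemma hk_lemA {n : ℕ} {ξ : Fin n → ℂ} {m : Fin n → ℕ} {h : Polynomial ℂ}
    (hξ : ∀ j, ξ j ∈ unitCircle) (hh : DivP h) :
    ∃ (K : ℝ) (D : ℕ), 0 ≤ K ∧ ∀ f, MemHb ξ m f → ∃ (g1 : ℂ → ℂ) (s : Polynomial ℂ),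
      MemH2 g1 ∧ s.natDegree ≤ D ∧ h2NormSq g1 ≤ K * hbNormSq ξ m f ∧
      h2NormSq (fun z => s.eval z) ≤ K * hbNormSq ξ m f ∧
      ∀ z ∈ unitDisk, f z = a1fun ξ m z * h.eval z * g1 z + s.eval z := by
  obtain ⟨C, D, hC, hdiv⟩ := hh
  obtain ⟨M, hM, hM2⟩ := hk_poly_mul (aPoly ξ m)
  refine ⟨C + 2 * M * C + 2, max ((aPoly ξ m).natDegree + D) (∑ j, m j), by positivity, fun f hf => ?_⟩
  obtain ⟨⟨g, q⟩, hd⟩ := hf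
  simp only at hd
  obtain ⟨g1, r, a1, a2, a3, a4, a5⟩ := hdiv g hd.1
  have h1 := hk_nonneg g
  have h2 := hk_nonneg (fun z => q.eval z)
  rw [hb_norm_eq hξ hd]
  have p1 : 0 ≤ M * C * h2NormSq g := by positivity
  have p2 : 0 ≤ C * h2NormSq g := by positivity
  have p3 : 0 ≤ M * C * h2NormSq (fun z => q.eval z) := by positivity
  have p4 : 0 ≤ C * h2NormSq (fun z => q.eval z) := by positivity
  refine ⟨g1, aPoly ξ m * r + q, a1, ?_, ?_, ?_, fun z hz => ?_⟩
  · refine (Polynomial.natDegree_add_le _ _).trans (max_le_max ?_ ?_)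
    · exact Polynomial.natDegree_mul_le.trans (by gcongr)
    · exact Polynomial.natDegree_le_of_degree_le hd.2.1.le
  · linarith
  · obtain ⟨b1, b2⟩ := hM2 _ (hk_poly r)
    have b3 := (hk_add b1 (hk_poly q)).2
    simp only [Polynomial.eval_add, Polynomial.eval_mul]
    have : M * h2NormSq (fun z => r.eval z) ≤ M * (C * h2NormSq g) := by gcongr
    linarith
  · rw [hd.2.2 z hz, a3 z hz]
    simp only [Polynomial.eval_add, Polynomial.eval_mul, aPoly_eval]
    ring

lemma hk_cs {g : ℂ → ℂ} (hg : MemH2 g) {ρ : ℝ} (h0 : 0 ≤ ρ) (h1 : ρ < 1) :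
    (∑' k, ‖taylorCoeff g k‖ * ρ ^ k) ^ 2 ≤ h2NormSq g / (1 - ρ ^ 2) := by
  have hr : (ρ : ℂ) ∈ unitDisk := by simp [unitDisk, abs_of_nonneg h0, h1]
  have hc : Summable fun k => ‖((‖taylorCoeff g k‖ : ℝ) : ℂ)‖ ^ 2 := by simpa using hg.2
  obtain ⟨a1, a2⟩ := hk_ofC hc
  have h2 := hk_growth a1 hr
  have h3 : h2NormSq (ofC fun k => ((‖taylorCoeff g k‖ : ℝ) : ℂ)) = h2NormSq g := by
    simp [h2NormSq, a2]
  have h4 : ofC (fun k => ((‖taylorCoeff g k‖ : ℝ) : ℂ)) ρ = ((∑' k, ‖taylorCoeff g k‖ * ρ ^ k : ℝ) : ℂ) := by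
    rw [ofC, ofReal_tsum]; simp
  rw [h3, h4, norm_real, norm_real, Real.norm_eq_abs, Real.norm_eq_abs, sq_abs, sq_abs] at h2
  exact h2

open Topology in
lemma hk_diag {x : ℕ → ℕ → ℂ} {B : ℝ} (hx : ∀ i k, ‖x i k‖ ≤ B) :
    ∃ (c : ℕ → ℂ) (κ : ℕ → ℕ), StrictMono κ ∧ ∀ k, Tendsto (fun i => x (κ i) k) atTop (𝓝 (c k)) := by
  have hc : IsCompact (Set.pi univ fun _ : ℕ => Metric.closedBall (0:ℂ) B) :=
    isCompact_univ_pi fun _ => isCompact_closedBall _ _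
  obtain ⟨c, -, κ, hκ, h⟩ := hc.tendsto_subseq (x := x) fun i k _ => by simpa using hx i k
  exact ⟨c, κ, hκ, fun k => (tendsto_pi_nhds.1 h) k⟩

open Topology in
lemma hk_limit_mem {x : ℕ → ℂ → ℂ} {K : ℝ} (hx : ∀ i, MemH2 (x i) ∧ h2NormSq (x i) ≤ K) {c : ℕ → ℂ}
    (h : ∀ k, Tendsto (fun i => taylorCoeff (x i) k) atTop (𝓝 (c k))) :
    MemH2 (ofC c) ∧ (∀ k, taylorCoeff (ofC c) k = c k) ∧ h2NormSq (ofC c) ≤ K := by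
  have hb : ∀ n, ∑ k ∈ Finset.range n, ‖c k‖ ^ 2 ≤ K := by
    intro n
    refine le_of_tendsto (tendsto_finsetSum (Finset.range n) fun k _ => ((h k).norm.pow 2))
      (Eventually.of_forall fun i => ?_)
    exact ((hx i).1.2.sum_le_tsum _ (fun _ _ => by positivity)).trans (hx i).2
  have hs : Summable fun k => ‖c k‖ ^ 2 := summable_of_sum_range_le (fun _ => by positivity) hb
  obtain ⟨h1, h2⟩ := hk_ofC hs
  refine ⟨h1, h2, ?_⟩
  simp only [h2NormSq, h2]
  exact Real.tsum_le_of_sum_range_le (fun _ => by positivity) hb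

open Topology in
lemma hk_tannery {x : ℕ → ℂ → ℂ} {K : ℝ} (hx : ∀ i, MemH2 (x i) ∧ h2NormSq (x i) ≤ K)
    (h : ∀ k, Tendsto (fun i => taylorCoeff (x i) k) atTop (𝓝 0)) {ρ : ℝ} (h0 : 0 ≤ ρ) (h1 : ρ < 1) :
    Tendsto (fun i => ∑' k, ‖taylorCoeff (x i) k‖ * ρ ^ k) atTop (𝓝 0) := by
  have := tendsto_tsum_of_dominated_convergence (𝓕 := atTop) (f := fun i k => ‖taylorCoeff (x i) k‖ * ρ ^ k)
    (g := fun _ => 0) (bound := fun k => Real.sqrt K * ρ ^ k)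
    ((summable_geometric_of_lt_one h0 h1).mul_left _) ?_ ?_
  · simpa using this
  · intro k
    simpa using (h k).norm.mul_const (ρ ^ k)
  · refine Eventually.of_forall fun i k => ?_
    rw [Real.norm_of_nonneg (by positivity)]
    refine mul_le_mul_of_nonneg_right ?_ (by positivity)
    exact Real.le_sqrt_of_sq_le ((hk_coeff_le (hx i).1 k).trans (hx i).2)

open Topology in
/-- Weighted composition sends coefficientwise null bounded sequences to null sequences. -/
lemma hk_null {φ u : ℂ → ℂ} (hφ : DifferentiableOn ℂ φ unitDisk) (hm : ∀ z ∈ unitDisk, φ z ∈ unitDisk)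
    (hu : MemH2 u)
    (hess : ∀ ε > (0:ℝ), ∃ ρ : ℝ, 0 ≤ ρ ∧ ρ < 1 ∧
      ∀ᵐ (θ : ℝ) ∂(volume.restrict (Set.Ioc (0:ℝ) (2 * Real.pi))),
        ρ < ‖bdryVal φ (Complex.exp (θ * Complex.I))‖ →
          ‖bdryVal u (Complex.exp (θ * Complex.I))‖ ≤ ε)
    {x : ℕ → ℂ → ℂ} {K : ℝ} (hx : ∀ i, MemH2 (x i) ∧ h2NormSq (x i) ≤ K)
    (h : ∀ k, Tendsto (fun i => taylorCoeff (x i) k) atTop (𝓝 0)) :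
    Tendsto (fun i => h2NormSq (fun z => u z * x i (φ z))) atTop (𝓝 0) := by
  have h00 : ‖φ 0‖ < 1 := hk_norm_lt (hm 0 (by simp [unitDisk]))
  have hd : 0 < 1 - ‖φ 0‖ := by linarith
  have hK : 0 ≤ K := (hk_nonneg _).trans (hx 0).2
  set L := (1 + ‖φ 0‖) / (1 - ‖φ 0‖) * K with hL
  have hL0 : 0 ≤ L := by positivity
  rw [Metric.tendsto_atTop']
  intro η hη
  have hq : 0 < η / (2 * (L + 1)) := by positivity
  obtain ⟨ρ, h0, h1, he⟩ := hess (Real.sqrt (η / (2 * (L + 1)))) (Real.sqrt_pos.2 hq)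
  have ht := ((hk_tannery hx h h0 h1).pow 2).mul_const (h2NormSq u)
  simp only [ne_eq, OfNat.ofNat_ne_zero, not_false_eq_true, zero_pow, zero_mul] at ht
  obtain ⟨N, hN⟩ := (ht.eventually (gt_mem_nhds (show 0 < η / 2 by positivity))).exists_forall_of_atTop
  refine ⟨N, fun i hi => ?_⟩
  have h3 := hN i hi.le
  have h4 := (hk_est hφ hm hu h0 h1 he (hx i).1).2
  rw [Real.sq_sqrt hq.le] at h4
  have h5 : (1 + ‖φ 0‖) / (1 - ‖φ 0‖) * h2NormSq (x i) ≤ L := by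
    rw [hL]; have := (hx i).2; gcongr
  have h6 : η / (2 * (L + 1)) * ((1 + ‖φ 0‖) / (1 - ‖φ 0‖) * h2NormSq (x i)) ≤ η / 2 := by
    calc _ ≤ η / (2 * (L + 1)) * L := by gcongr
      _ ≤ η / (2 * (L + 1)) * (L + 1) := by gcongr; linarith
      _ = η / 2 := by field_simp
  rw [dist_zero_right, Real.norm_of_nonneg (hk_nonneg _)]
  linarith


/-- Corollary 5.5. If `u ∈ H²` and the essential supremum of `|u|` on
`A_δ = {ζ ∈ T : |φ(ζ)| ≥ 1 − δ}` tends to `0` as `δ → 0`, then `C_φ` is compact on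
`H(b)`. -/
theorem comp_compact_of_esssup_to_zero
    (b a : ℂ → ℂ) (n : ℕ) (ξ : Fin n → ℂ) (m : Fin n → ℕ)
    (hset : RationalSetting b a n ξ m)
    (φ : ℂ → ℂ) (hφb : MemHb ξ m φ) (hφball : MemBallHinf φ)
    (hφmap : ∀ z ∈ unitDisk, φ z ∈ unitDisk)
    (Λ : Fin n → ℂ) (hΛ : ∀ j, NTLimit φ (ξ j) (Λ j))
    (p : ℕ) (hp : p ≤ n)
    (hΛcirc : ∀ j : Fin n, (j : ℕ) < p → ∃ i, Λ j = ξ i)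
    (hΛdisk : ∀ j : Fin n, p ≤ (j : ℕ) → Λ j ∈ unitDisk)
    (hu : MemH2 (ufun p ξ m Λ φ))
    (hess : ∀ ε > (0:ℝ), ∃ δ > (0:ℝ),
      ∀ᵐ (θ : ℝ) ∂(volume.restrict (Set.Ioc (0:ℝ) (2 * Real.pi))),
        1 - δ ≤ ‖bdryVal φ (Complex.exp (θ * Complex.I))‖ →
          ‖bdryVal (ufun p ξ m Λ φ) (Complex.exp (θ * Complex.I))‖ ≤ ε) :
    CompCompactHb ξ m φ := by
  have hξ := hset.zeros_mem
  have hφ := hφball.1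
  set u := ufun p ξ m Λ φ with hudef
  set h : Polynomial ℂ := ∏ j ∈ Finset.univ.filter fun j : Fin n => p ≤ (j : ℕ),
    (Polynomial.X - Polynomial.C (Λ j)) ^ (m j) with hh
  have hdiv : DivP h := by
    refine Finset.prod_induction _ DivP (fun _ _ => divP_mul) divP_one fun j hj => divP_pow (divP_X ?_) _
    exact hΛdisk j (Finset.mem_filter.1 hj).2
  have hun : ∀ z ∈ unitDisk, a1fun ξ m (φ z) * h.eval (φ z) = a1fun ξ m z * u z := by
    intro z hz
    have hne : a1fun ξ m z ≠ 0 := by rw [← aPoly_eval]; exact (aPoly_good m hξ).1 z hz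
    rw [hudef, ufun, mul_div_cancel₀ _ hne, hh, Polynomial.eval_prod]
    simp
  have hess' : ∀ ε > (0:ℝ), ∃ ρ : ℝ, 0 ≤ ρ ∧ ρ < 1 ∧
      ∀ᵐ (θ : ℝ) ∂(volume.restrict (Set.Ioc (0:ℝ) (2 * Real.pi))),
        ρ < ‖bdryVal φ (Complex.exp (θ * Complex.I))‖ →
          ‖bdryVal u (Complex.exp (θ * Complex.I))‖ ≤ ε := by
    intro ε hε
    obtain ⟨δ, hδ, hd⟩ := hess ε hε
    refine ⟨max (1 - δ) 0, le_max_right _ _, max_lt (by linarith) one_pos, ?_⟩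
    filter_upwards [hd] with θ h1 h2
    exact h1 ((le_max_left _ _).trans h2.le)
  obtain ⟨K, D, hK, hA⟩ := hk_lemA (ξ := ξ) (m := m) hξ hdiv
  obtain ⟨K', hK', hB⟩ := hk_lemB (u := u) hξ hφb hφ hφmap hun D
  obtain ⟨ρ, hρ0, hρ1, hρ⟩ := hess' 1 one_pos
  have hest := fun (g : ℂ → ℂ) (hg : MemH2 g) => hk_est hφ hφmap hu hρ0 hρ1 hρ hg
  have hcomp : ∀ (f g1 : ℂ → ℂ) (s : Polynomial ℂ),
      (∀ z ∈ unitDisk, f z = a1fun ξ m z * h.eval z * g1 z + s.eval z) →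
      ∀ z ∈ unitDisk, f (φ z) = a1fun ξ m (φ z) * h.eval (φ z) * g1 (φ z) + s.eval (φ z) :=
    fun f g1 s hf z hz => hf _ (hφmap z hz)
  refine ⟨⟨fun f hf => ?_, ?_⟩, fun f hf => ?_⟩
  · obtain ⟨g1, s, a1, a2, a3, a4, a5⟩ := hA f hf
    exact (hB g1 s _ a2 (hest g1 a1).1 (hcomp f g1 s a5)).1
  · have h00 : ‖φ 0‖ < 1 := hk_norm_lt (hφmap 0 (by simp [unitDisk]))
    have hd : 0 < 1 - ‖φ 0‖ := by linarith
    have hd2 : 0 < 1 - ρ ^ 2 := by nlinarith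
    have hu0 := hk_nonneg u
    refine ⟨2 * (((1 + ‖φ 0‖) / (1 - ‖φ 0‖)) + (1 - ρ ^ 2)⁻¹ * h2NormSq u) * K + K' * K, fun f hf => ?_⟩
    obtain ⟨g1, s, a1, a2, a3, a4, a5⟩ := hA f hf
    have h1 := (hB g1 s _ a2 (hest g1 a1).1 (hcomp f g1 s a5)).2
    have h2 := (hest g1 a1).2
    have h3 := hk_cs a1 hρ0 hρ1
    rw [div_eq_inv_mul] at h3
    rw [one_pow, one_mul] at h2
    have hE : 0 ≤ (1 + ‖φ 0‖) / (1 - ‖φ 0‖) := by positivity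
    have hE2 : 0 ≤ (1 - ρ ^ 2)⁻¹ := by positivity
    generalize (1 + ‖φ 0‖) / (1 - ‖φ 0‖) = E at *
    generalize (1 - ρ ^ 2)⁻¹ = E2 at *
    have h4 : (∑' k, ‖taylorCoeff g1 k‖ * ρ ^ k) ^ 2 * h2NormSq u ≤ E2 * h2NormSq g1 * h2NormSq u := by
      gcongr
    have h5 : (E + E2 * h2NormSq u) * h2NormSq g1 ≤ (E + E2 * h2NormSq u) * (K * hbNormSq ξ m f) := by
      gcongr
    have h6 : K' * h2NormSq (fun z => s.eval z) ≤ K' * (K * hbNormSq ξ m f) := by gcongr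
    linarith
  · choose g s a1 a2 a3 a4 a5 using fun k => hA (f k) (hf k).1
    have hb : ∀ k, K * hbNormSq ξ m (f k) ≤ K := fun k => mul_le_of_le_one_right hK (hf k).2
    have hgK : ∀ k, MemH2 (g k) ∧ h2NormSq (g k) ≤ K := fun k => ⟨a1 k, (a3 k).trans (hb k)⟩
    obtain ⟨c, κ1, hκ1, hc⟩ := hk_diag (x := fun i k => taylorCoeff (g i) k) (B := Real.sqrt K) fun i k =>
      Real.le_sqrt_of_sq_le ((hk_coeff_le (a1 i) k).trans (hgK i).2)
    obtain ⟨d, κ2, hκ2, hd⟩ := hk_diag (x := fun i k => (s (κ1 i)).coeff k) (B := Real.sqrt K) fun i k => by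
      have h1 := hk_coeff_le (hk_poly (s (κ1 i))) k
      rw [hk_poly_coeff] at h1
      exact Real.le_sqrt_of_sq_le (h1.trans ((a4 _).trans (hb _)))
    set κ : ℕ → ℕ := fun i => κ1 (κ2 i) with hκ
    have hc' : ∀ k, Tendsto (fun i => taylorCoeff (g (κ i)) k) atTop (nhds (c k)) := fun k =>
      (hc k).comp hκ2.tendsto_atTop
    obtain ⟨l1, l2, l3⟩ := hk_limit_mem (x := fun i => g (κ i)) (fun i => hgK _) hc'
    have hSdeg : (truncP d (D + 1)).natDegree ≤ D := by
      refine Polynomial.natDegree_le_iff_coeff_eq_zero.2 fun k hk => ?_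
      rw [truncP_coeff, if_neg (by omega)]
    refine ⟨κ, fun z => a1fun ξ m (φ z) * h.eval (φ z) * ofC c (φ z) + (truncP d (D + 1)).eval (φ z),
      hκ1.comp hκ2, (hB (ofC c) (truncP d (D + 1)) _ hSdeg (hest _ l1).1 fun z _ => rfl).1, ?_⟩
    have hx : ∀ i, MemH2 (fun z => g (κ i) z - ofC c z) ∧
        h2NormSq (fun z => g (κ i) z - ofC c z) ≤ 4 * K := by
      intro i
      obtain ⟨q1, q2⟩ := hk_sub (a1 (κ i)) l1
      exact ⟨q1, q2.trans (by linarith [(hgK (κ i)).2])⟩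
    have hnull := hk_null hφ hφmap hu hess' hx fun k => by
      have := (hc' k).sub_const (c k)
      rw [sub_self] at this
      refine this.congr fun i => ?_
      rw [hk_coeff_sub (a1 (κ i)).1 l1.1, l2]
    have hdegs : ∀ i, (s (κ i) - truncP d (D + 1)).natDegree ≤ D := fun i =>
      (Polynomial.natDegree_sub_le _ _).trans (max_le (a2 _) hSdeg)
    have hsnull : Tendsto (fun i => h2NormSq (fun z => (s (κ i) - truncP d (D + 1)).eval z)) atTop (nhds 0) := by
      have h1 : Tendsto (fun i => ∑ k ∈ Finset.range (D + 1), ‖(s (κ i) - truncP d (D + 1)).coeff k‖ ^ 2)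
          atTop (nhds (∑ k ∈ Finset.range (D + 1), (0:ℝ))) := by
        refine tendsto_finsetSum _ fun k hk => ?_
        have h2 := (((hd k).sub_const (d k)).norm.pow 2)
        rw [sub_self, norm_zero, zero_pow two_ne_zero] at h2
        refine h2.congr fun i => ?_
        rw [Polynomial.coeff_sub, truncP_coeff, if_pos (Finset.mem_range.1 hk)]
      rw [Finset.sum_const_zero] at h1
      refine h1.congr fun i => ?_
      rw [hk_poly_norm_eq (hdegs i)]
    have htot := (hnull.const_mul 2).add (hsnull.const_mul K')
    simp only [mul_zero, add_zero] at htot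
    refine squeeze_zero (fun i => ?_) (fun i => ?_) htot
    · exact add_nonneg (hk_nonneg _) (hk_nonneg _)
    · refine (hB (fun z => g (κ i) z - ofC c z) (s (κ i) - truncP d (D + 1)) _ (hdegs i) (hest _ (hx i).1).1
        fun z hz => ?_).2
      rw [hcomp _ _ _ (a5 (κ i)) z hz, Polynomial.eval_sub]
      ring

end
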